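/- arXiv:2601.07938 — 4 statements merged into one kernel-verified Lean document; each statement's English description precedes it below -/
import Mathlib

section
/- The number of rooted labeled trees on vertex set {1,...,n} with exactly k records equals k · (n-1)(n-2)···(n-k+1) · n^(n-k-1). -/
/-- A parent map encoding of a rooted labeled tree on `Fin n`:
there is a root `r` (a fixed point) which every vertex reaches by iteration. -/
def IsTreeFun {n : ℕ} (f : Fin n → Fin n) : Prop :=
  ∃ r, f r = r ∧ ∀ v, ∃ k, f^[k] v = r

/-- `v` is a record: its label is maximal on the path from `v` to the root. -/
def IsRec {n : ℕ} (f : Fin n → Fin n) (v : Fin n) : Prop :=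
  ∀ k, f^[k] v ≤ v

section Forests

variable {α : Type*}

/-- `w` lies on the forward orbit of `v` under `f`. -/
def Reach (f : α → α) (v w : α) : Prop := ∃ j, f^[j] v = w

theorem Reach.refl (f : α → α) (v : α) : Reach f v v := ⟨0, rfl⟩

theorem Reach.iterate (f : α → α) (v : α) (j : ℕ) : Reach f v (f^[j] v) := ⟨j, rfl⟩

theorem Reach.trans {f : α → α} {u v w : α} (h₁ : Reach f u v) (h₂ : Reach f v w) :
    Reach f u w := by
  obtain ⟨i, rfl⟩ := h₁
  obtain ⟨j, rfl⟩ := h₂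
  exact ⟨j + i, Function.iterate_add_apply f j i u⟩

theorem Reach.of_apply {f : α → α} {v w : α} (h : Reach f (f v) w) : Reach f v w :=
  Reach.trans ⟨1, rfl⟩ h

theorem Reach.apply_of_ne {f : α → α} {v w : α} (h : Reach f v w) (hne : v ≠ w) :
    Reach f (f v) w := by
  obtain ⟨_ | j, hj⟩ := h
  · exact absurd hj hne
  · exact ⟨j, hj⟩

theorem Reach.apply_of_fixed {f : α → α} {v w : α} (h : Reach f v w) (hw : f w = w) :
    Reach f (f v) w := by
  by_cases hne : v = w
  · subst hne
    rw [hw]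
    exact Reach.refl f v
  · exact h.apply_of_ne hne

theorem Reach.eq_of_fixed {f : α → α} {v w : α} (h : Reach f v w) (hv : f v = v) : w = v := by
  obtain ⟨j, rfl⟩ := h
  exact Function.iterate_fixed hv j

/-- Two fixed points on the same orbit coincide. -/
theorem Reach.fixed_unique {f : α → α} {v a b : α} (ha : Reach f v a) (hb : Reach f v b)
    (hfa : f a = a) (hfb : f b = b) : a = b := by
  obtain ⟨i, rfl⟩ := ha
  obtain ⟨j, rfl⟩ := hb
  have h₁ := Function.iterate_fixed hfa j
  have h₂ := Function.iterate_fixed hfb i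
  rw [← Function.iterate_add_apply] at h₁ h₂
  rw [← h₁, ← h₂, Nat.add_comm]

/-- A point with an orbit ending in a fixed point is not on a cycle unless it is fixed. -/
theorem Reach.fixed_of_cycle {f : α → α} {v r : α} (hr : Reach f v r) (hfr : f r = r)
    (hc : Reach f (f v) v) : f v = v := by
  obtain ⟨i, hi⟩ := hr
  obtain ⟨j, hj⟩ := hc
  have hp : Function.IsPeriodicPt f (j + 1) v := hj
  have h₁ : f^[(j + 1) * i] v = v := hp.mul_const i
  have h₂ : f^[(j + 1) * i] v = r := by
    have : (j + 1) * i = j * i + i := by ring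
    rw [this, Function.iterate_add_apply, hi, Function.iterate_fixed hfr]
  rw [← h₁.symm.trans h₂] at hfr
  exact hfr

/-- If `f` and `h` agree on a set closed under `h`, they have the same orbits there. -/
theorem iterate_eq_of_eqOn {f h : α → α} {p : α → Prop} (hcl : ∀ v, p v → p (h v))
    (heq : ∀ v, p v → f v = h v) (j : ℕ) : ∀ v, p v → f^[j] v = h^[j] v := by
  induction j with
  | zero => intro v _; rfl
  | succ j ih =>
    intro v hv
    rw [Function.iterate_succ_apply, Function.iterate_succ_apply, heq v hv, ih _ (hcl v hv)]

theorem reach_congr {f h : α → α} {p : α → Prop} (hcl : ∀ v, p v → p (h v))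
    (heq : ∀ v, p v → f v = h v) {v : α} (hv : p v) (w : α) : Reach f v w ↔ Reach h v w := by
  simp only [Reach, iterate_eq_of_eqOn hcl heq _ v hv]

theorem Reach.mem_of_closed {f : α → α} {p : α → Prop} (hcl : ∀ v, p v → p (f v)) {v w : α}
    (hv : p v) (h : Reach f v w) : p w := by
  obtain ⟨j, rfl⟩ := h
  induction j generalizing v with
  | zero => exact hv
  | succ j ih => exact ih (hcl v hv)

/-- Maps that agree away from a target have the same orbits into that target. -/
theorem Reach.of_agree {f h : α → α} {v m : α}
    (heq : ∀ w, Reach h w m → w ≠ m → f w = h w) (hv : Reach h v m) : Reach f v m := by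
  obtain ⟨j, hj⟩ := hv
  induction j generalizing v with
  | zero => exact ⟨0, hj⟩
  | succ j ih =>
    by_cases hvm : v = m
    · subst hvm; exact Reach.refl f v
    · apply Reach.of_apply
      rw [heq v ⟨j + 1, hj⟩ hvm]
      exact ih hj

theorem reach_conj (σ : Equiv.Perm α) (f : α → α) (v w : α) :
    Reach (σ ∘ f ∘ σ.symm) v w ↔ Reach f (σ.symm v) (σ.symm w) := by
  have key (j : ℕ) (v : α) : (σ ∘ f ∘ σ.symm)^[j] v = σ (f^[j] (σ.symm v)) := by
    induction j generalizing v with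
    | zero => simp
    | succ j ih => simp [Function.iterate_succ_apply, ih]
  simp only [Reach, key, Equiv.eq_symm_apply]

theorem reach_update_self_iff [DecidableEq α] {f : α → α} {c : α} (x : α) (v : α) :
    Reach (Function.update f c x) v c ↔ Reach f v c :=
  ⟨Reach.of_agree fun w _ hw => by rw [Function.update_of_ne hw],
    Reach.of_agree fun w _ hw => by rw [Function.update_of_ne hw]⟩

theorem reach_update_iff_of_not_reach [DecidableEq α] {f : α → α} {c v : α} (x : α)
    (hv : ¬ Reach f v c) (w : α) :
    Reach (Function.update f c x) v w ↔ Reach f v w := by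
  refine reach_congr (p := fun u => ¬ Reach f u c) (fun u hu h => hu h.of_apply)
    (fun u hu => Function.update_of_ne ?_ _ _) hv w
  rintro rfl
  exact hu (Reach.refl f u)

open scoped Classical in
/-- Turn every vertex of `s` outside the tree of `m` into a root. -/
noncomputable def isolate (s : Finset α) (m : α) (f : α → α) : α → α :=
  fun v => if v ∈ s ∧ ¬ Reach f v m then v else f v

open scoped Classical in
/-- The vertices of `s` outside the tree of `m`. -/
noncomputable def outside (s : Finset α) (m : α) (f : α → α) : Finset α :=
  s.filter fun v => ¬ Reach f v m

theorem mem_outside {s : Finset α} {m v : α} {f : α → α} :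
    v ∈ outside s m f ↔ v ∈ s ∧ ¬ Reach f v m := by
  simp [outside]

theorem outside_subset (s : Finset α) (m : α) (f : α → α) : outside s m f ⊆ s :=
  fun _ hv => (mem_outside.1 hv).1

theorem root_notMem_outside (s : Finset α) (m : α) (f : α → α) : m ∉ outside s m f :=
  fun h => (mem_outside.1 h).2 (Reach.refl f m)

theorem isolate_of_reach {s : Finset α} {m v : α} {f : α → α} (h : Reach f v m) :
    isolate s m f v = f v := by
  simp [isolate, h]

theorem isolate_of_notMem {s : Finset α} {m v : α} {f : α → α} (h : v ∉ s) :
    isolate s m f v = f v := by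
  simp [isolate, h]

theorem isolate_of_not_reach {s : Finset α} {m v : α} {f : α → α} (hs : v ∈ s)
    (h : ¬ Reach f v m) : isolate s m f v = v := by
  simp [isolate, h, hs]

theorem reach_isolate_iff {s : Finset α} {m v : α} {f : α → α} (hv : v ∈ s) :
    Reach (isolate s m f) v m ↔ Reach f v m := by
  refine ⟨fun h => ?_, Reach.of_agree fun w hw _ => isolate_of_reach hw⟩
  by_contra hn
  have := h.eq_of_fixed (isolate_of_not_reach hv hn)
  exact hn (this ▸ Reach.refl f m)

variable [Fintype α]

open scoped Classical in
/-- Self-maps of `s`, extended by `g` outside `s`. -/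
noncomputable def mapsOn (s : Finset α) (g : α → α) : Finset (α → α) :=
  Finset.univ.filter fun f => (∀ v ∉ s, f v = g v) ∧ ∀ v ∈ s, f v ∈ s

open scoped Classical in
/-- Rooted forests on `s` with exactly `k` roots (fixed points), extended by `g` outside `s`. -/
noncomputable def forestsOn (s : Finset α) (g : α → α) (k : ℕ) : Finset (α → α) :=
  (mapsOn s g).filter fun f =>
    (∀ v ∈ s, ∃ w, Reach f v w ∧ f w = w) ∧ (s.filter fun v => f v = v).card = k

theorem mem_mapsOn {s : Finset α} {g f : α → α} :
    f ∈ mapsOn s g ↔ (∀ v ∉ s, f v = g v) ∧ ∀ v ∈ s, f v ∈ s := by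
  simp [mapsOn]

open scoped Classical in
theorem mem_forestsOn {s : Finset α} {g f : α → α} {k : ℕ} :
    f ∈ forestsOn s g k ↔ f ∈ mapsOn s g ∧ (∀ v ∈ s, ∃ w, Reach f v w ∧ f w = w) ∧
      (s.filter fun v => f v = v).card = k := by
  simp [forestsOn]

open scoped Classical in
theorem conj_swap_mem_forestsOn {s : Finset α} {g f : α → α} {k : ℕ} (hg : ∀ v ∉ s, g v ∉ s)
    {a b : α} (ha : a ∈ s) (hb : b ∈ s) (hf : f ∈ forestsOn s g k) :
    Equiv.swap a b ∘ f ∘ (Equiv.swap a b).symm ∈ forestsOn s g k := by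
  set σ := Equiv.swap a b with hσ
  have hσs : ∀ v, σ v ∈ s ↔ v ∈ s := by
    intro v
    rw [hσ, Equiv.swap_apply_def]
    split_ifs with h₁ h₂
    · subst h₁; simp [ha, hb]
    · subst h₂; simp [ha, hb]
    · rfl
  have hσn : ∀ v ∉ s, σ v = v := fun v hv =>
    Equiv.swap_apply_of_ne_of_ne (fun h => hv (h ▸ ha)) (fun h => hv (h ▸ hb))
  have hσσ : ∀ v, σ (σ v) = v := fun v => Equiv.swap_apply_self a b v
  have hsymm : σ.symm = σ := Equiv.symm_swap a b
  obtain ⟨hm, hr, hc⟩ := mem_forestsOn.1 hf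
  obtain ⟨hm₁, hm₂⟩ := mem_mapsOn.1 hm
  refine mem_forestsOn.2 ⟨mem_mapsOn.2 ⟨fun v hv => ?_, fun v hv => ?_⟩, fun v hv => ?_, ?_⟩
  · simp only [Function.comp, hsymm]
    rw [hσn v hv, hm₁ v hv, hσn _ (hg v hv)]
  · simp only [Function.comp, hsymm]
    exact (hσs _).2 (hm₂ _ ((hσs v).2 hv))
  · obtain ⟨w, hw, hfw⟩ := hr (σ v) ((hσs v).2 hv)
    refine ⟨σ w, ?_, ?_⟩
    · rw [reach_conj, hsymm, hσσ]
      exact hw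
    · simp [hsymm, hσσ, hfw]
  · rw [← hc]
    refine Finset.card_nbij' σ σ ?_ ?_ (fun v _ => hσσ v) (fun v _ => hσσ v)
    · intro v hv
      simp only [Finset.coe_filter, Set.mem_ofPred_eq, Function.comp, hsymm] at hv ⊢
      exact ⟨(hσs v).2 hv.1, by rw [← hσσ (f (σ v)), hv.2]⟩
    · intro v hv
      simp only [Finset.coe_filter, Set.mem_ofPred_eq, Function.comp, hsymm] at hv ⊢
      exact ⟨(hσs v).2 hv.1, by rw [hσσ, hv.2]⟩

open scoped Classical in
/-- By symmetry, every vertex of `s` is equally often a root. -/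
theorem card_mul_card_forestsOn_fixing {s : Finset α} {g : α → α} (hg : ∀ v ∉ s, g v ∉ s)
    {m : α} (hm : m ∈ s) (k : ℕ) :
    s.card * ((forestsOn s g k).filter fun f => f m = m).card = k * (forestsOn s g k).card := by
  have h₁ : ∑ f ∈ forestsOn s g k, (s.filter fun v => f v = v).card =
      ∑ v ∈ s, ((forestsOn s g k).filter fun f => f v = v).card :=
    Finset.sum_card_bipartiteAbove_eq_sum_card_bipartiteBelow (fun (f : α → α) v => f v = v)
  rw [Finset.sum_congr rfl (fun f hf => (mem_forestsOn.1 hf).2.2), Finset.sum_const, smul_eq_mul]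
    at h₁
  rw [mul_comm k, h₁, Finset.sum_congr rfl (g := fun _ =>
    ((forestsOn s g k).filter fun f => f m = m).card), Finset.sum_const, smul_eq_mul]
  intro v hv
  have hinv : ∀ f : α → α, Equiv.swap v m ∘ (Equiv.swap v m ∘ f ∘ (Equiv.swap v m).symm) ∘
      (Equiv.swap v m).symm = f := by
    intro f
    funext x
    simp
  refine Finset.card_nbij' (fun f => Equiv.swap v m ∘ f ∘ (Equiv.swap v m).symm)
    (fun f => Equiv.swap v m ∘ f ∘ (Equiv.swap v m).symm) ?_ ?_
    (fun f _ => hinv f) (fun f _ => hinv f)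
  · intro f hf
    simp only [Finset.coe_filter, Set.mem_ofPred_eq] at hf ⊢
    exact ⟨conj_swap_mem_forestsOn hg hv hm hf.1, by simp [hf.2]⟩
  · intro f hf
    simp only [Finset.coe_filter, Set.mem_ofPred_eq] at hf ⊢
    exact ⟨conj_swap_mem_forestsOn hg hv hm hf.1, by simp [hf.2]⟩

open scoped Classical in
theorem mem_forestsOn_univ {f : α → α} {k : ℕ} :
    f ∈ forestsOn Finset.univ id k ↔ (∀ v, ∃ w, Reach f v w ∧ f w = w) ∧
      (Finset.univ.filter fun v => f v = v).card = k := by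
  simp [mem_forestsOn, mem_mapsOn]

open scoped Classical in
/-- Each vertex of a forest with `k` roots lies in the trees of all but `k - 1` of the roots. -/
theorem card_not_reach_add {f : α → α} {k : ℕ} (hf : f ∈ forestsOn Finset.univ id k) :
    (Finset.univ.filter fun q : α × α => f q.1 = q.1 ∧ ¬ Reach f q.2 q.1).card +
      Fintype.card α = k * Fintype.card α := by
  obtain ⟨hr, hk⟩ := mem_forestsOn_univ.1 hf
  choose ρ hρ hfρ using hr
  have h₁ : (Finset.univ.filter fun q : α × α => f q.1 = q.1 ∧ Reach f q.2 q.1).card =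
      Fintype.card α := by
    rw [← Finset.card_univ]
    refine Finset.card_nbij' (fun q => q.2) (fun v => (ρ v, v)) ?_ ?_ ?_ ?_
    · intro q _; simp
    · intro v _; simp [hρ, hfρ]
    · rintro ⟨c, v⟩ hq
      simp only [Finset.coe_filter, Finset.mem_univ, true_and, Set.mem_ofPred_eq] at hq
      simp [(hρ v).fixed_unique hq.2 (hfρ v) hq.1]
    · intro v _; rfl
  have h₂ : (Finset.univ.filter fun q : α × α => f q.1 = q.1).card = k * Fintype.card α := by
    rw [← hk, ← Finset.card_univ, ← Finset.card_product]
    congr 1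
    ext q
    simp
  rw [← h₂, ← Finset.card_filter_add_card_filter_not
    (s := Finset.univ.filter fun q : α × α => f q.1 = q.1) (fun q => Reach f q.2 q.1),
    Finset.filter_filter, Finset.filter_filter, h₁, add_comm]

open scoped Classical in
/-- Cutting the edge above a non-root `c` of a forest makes `c` a root. -/
theorem update_self_mem_forestsOn {f : α → α} {k : ℕ} (hf : f ∈ forestsOn Finset.univ id k)
    {c : α} (hc : f c ≠ c) :
    Function.update f c c ∈ forestsOn Finset.univ id (k + 1) := by
  obtain ⟨hr, hk⟩ := mem_forestsOn_univ.1 hf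
  refine mem_forestsOn_univ.2 ⟨fun v => ?_, ?_⟩
  · by_cases hv : Reach f v c
    · exact ⟨c, (reach_update_self_iff c v).2 hv, Function.update_self ..⟩
    · obtain ⟨w, hw, hfw⟩ := hr v
      refine ⟨w, (reach_update_iff_of_not_reach c hv w).2 hw, ?_⟩
      rw [Function.update_of_ne, hfw]
      rintro rfl
      exact hv hw
  · have : (Finset.univ.filter fun v => Function.update f c c v = v) =
        insert c (Finset.univ.filter fun v => f v = v) := by
      ext v
      by_cases hv : v = c
      · simp [hv]
      · simp [hv]
    rw [this, Finset.card_insert_of_notMem (by simp [hc]), hk]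

open scoped Classical in
/-- Attaching a root `c` of a forest to a vertex of another tree gives a forest. -/
theorem update_mem_forestsOn {f : α → α} {k : ℕ} (hf : f ∈ forestsOn Finset.univ id (k + 1))
    {c p : α} (hc : f c = c) (hp : ¬ Reach f p c) :
    Function.update f c p ∈ forestsOn Finset.univ id k := by
  obtain ⟨hr, hk⟩ := mem_forestsOn_univ.1 hf
  have hpc : p ≠ c := by
    rintro rfl
    exact hp (Reach.refl f p)
  have hout : ∀ v, ¬ Reach f v c → ∃ w, Reach (Function.update f c p) v w ∧
      Function.update f c p w = w := by
    intro v hv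
    obtain ⟨w, hw, hfw⟩ := hr v
    refine ⟨w, (reach_update_iff_of_not_reach p hv w).2 hw, ?_⟩
    rw [Function.update_of_ne, hfw]
    rintro rfl
    exact hv hw
  refine mem_forestsOn_univ.2 ⟨fun v => ?_, ?_⟩
  · by_cases hv : Reach f v c
    · obtain ⟨w, hw, hfw⟩ := hout p hp
      refine ⟨w, ((reach_update_self_iff p v).2 hv).trans (Reach.of_apply ?_), hfw⟩
      rwa [Function.update_self]
    · exact hout v hv
  · have : (Finset.univ.filter fun v => f v = v) =
        insert c (Finset.univ.filter fun v => Function.update f c p v = v) := by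
      ext v
      by_cases hv : v = c
      · simp [hv, hc]
      · simp [hv]
    rw [this, Finset.card_insert_of_notMem (by simp [hpc])] at hk
    omega

open scoped Classical in
/-- A double count of the ways to turn a forest with `k + 1` roots into one with `k` roots. -/
theorem card_forestsOn_mul_sub (k : ℕ) :
    (forestsOn (Finset.univ : Finset α) id k).card * (Fintype.card α - k) =
      (forestsOn (Finset.univ : Finset α) id (k + 1)).card * (k * Fintype.card α) := by
  have h₁ : ((forestsOn (Finset.univ : Finset α) id k).sigma fun f =>
      Finset.univ.filter fun c => f c ≠ c).card =
      (forestsOn (Finset.univ : Finset α) id k).card * (Fintype.card α - k) := by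
    rw [Finset.card_sigma, Finset.sum_congr rfl (g := fun _ => Fintype.card α - k),
      Finset.sum_const, smul_eq_mul]
    intro f hf
    rw [← (mem_forestsOn_univ.1 hf).2, ← Finset.card_univ,
      ← Finset.card_filter_add_card_filter_not (s := Finset.univ) (fun v => f v = v)]
    simp
  have h₂ : ((forestsOn (Finset.univ : Finset α) id (k + 1)).sigma fun f =>
      Finset.univ.filter fun q : α × α => f q.1 = q.1 ∧ ¬ Reach f q.2 q.1).card =
      (forestsOn (Finset.univ : Finset α) id (k + 1)).card * (k * Fintype.card α) := by
    rw [Finset.card_sigma, Finset.sum_congr rfl (g := fun _ => k * Fintype.card α),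
      Finset.sum_const, smul_eq_mul]
    intro f hf
    have := card_not_reach_add hf
    rw [add_mul, one_mul] at this
    exact Nat.add_right_cancel this
  rw [← h₁, ← h₂]
  refine Finset.card_nbij' (fun x => ⟨Function.update x.1 x.2 x.2, (x.2, x.1 x.2)⟩)
    (fun y => ⟨Function.update y.1 y.2.1 y.2.2, y.2.1⟩) ?_ ?_ ?_ ?_
  · rintro ⟨f, c⟩ hx
    simp only [Finset.coe_sigma, Set.mem_sigma_iff, Finset.mem_coe, Finset.mem_filter,
      Finset.mem_univ, true_and] at hx ⊢
    refine ⟨update_self_mem_forestsOn hx.1 hx.2, Function.update_self .., fun h => hx.2 ?_⟩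
    obtain ⟨r, hr, hfr⟩ := (mem_forestsOn_univ.1 hx.1).1 c
    exact hr.fixed_of_cycle hfr ((reach_update_self_iff c _).1 h)
  · rintro ⟨f, c, p⟩ hy
    simp only [Finset.coe_sigma, Set.mem_sigma_iff, Finset.mem_coe, Finset.mem_filter,
      Finset.mem_univ, true_and] at hy ⊢
    refine ⟨update_mem_forestsOn hy.1 hy.2.1 hy.2.2, ?_⟩
    rw [Function.update_self]
    rintro rfl
    exact hy.2.2 (Reach.refl f p)
  · rintro ⟨f, c⟩ _
    simp
  · rintro ⟨f, c, p⟩ hy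
    simp only [Finset.coe_sigma, Set.mem_sigma_iff, Finset.mem_coe, Finset.mem_filter,
      Finset.mem_univ, true_and] at hy
    have : Function.update f c c = f := by
      conv_lhs => rw [← hy.2.1]
      rw [hy.2.1]
      exact Function.update_eq_self_iff.2 hy.2.1.symm
    simp [this]

/-- The number of rooted forests with `k` roots. -/
theorem card_forestsOn_univ_mul [Nonempty α] (k : ℕ) (hk : k ≤ Fintype.card α) :
    (forestsOn (Finset.univ : Finset α) id k).card * Fintype.card α =
      (Fintype.card α).choose k * k * Fintype.card α ^ (Fintype.card α - k) := by
  classical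
  induction hk using Nat.decreasingInduction with
  | self =>
    have : forestsOn (Finset.univ : Finset α) id (Fintype.card α) = {id} := by
      ext f
      rw [mem_forestsOn_univ, Finset.mem_singleton, ← Finset.card_univ, Finset.card_filter_eq_iff]
      constructor
      · rintro ⟨_, h⟩
        funext v
        exact h v (Finset.mem_univ v)
      · rintro rfl
        exact ⟨fun v => ⟨v, Reach.refl _ v, rfl⟩, fun _ _ => rfl⟩
    simp [this]
  | of_succ k hk ih =>
    have h₁ := card_forestsOn_mul_sub (α := α) k
    have h₂ := Nat.choose_succ_right_eq (Fintype.card α) k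
    obtain ⟨d, hd⟩ : ∃ d, Fintype.card α = k + 1 + d := Nat.exists_eq_add_of_le hk
    generalize (forestsOn (Finset.univ : Finset α) id k).card = F₀ at *
    generalize (forestsOn (Finset.univ : Finset α) id (k + 1)).card = F₁ at *
    generalize Fintype.card α = n at *
    have e₁ : n - k = d + 1 := by omega
    have e₂ : n - (k + 1) = d := by omega
    rw [e₁] at h₁ h₂ ⊢
    rw [e₂] at ih
    apply Nat.eq_of_mul_eq_mul_right (show 0 < d + 1 by omega)
    calc F₀ * n * (d + 1) = (F₀ * (d + 1)) * n := by ring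
      _ = (F₁ * n) * (k * n) := by rw [h₁]; ring
      _ = (n.choose (k + 1) * (k + 1)) * (k * n ^ (d + 1)) := by rw [ih]; ring
      _ = _ := by rw [h₂]; ring

/-- `f` is a self-map of `s` for which each vertex of `s` is fixed or in the tree rooted at `m`. -/
def IsIsolated (s : Finset α) (g : α → α) (m : α) (f : α → α) : Prop :=
  f ∈ mapsOn s g ∧ f m = m ∧ ∀ v ∈ s, ¬ Reach f v m → f v = v

theorem isIsolated_isolate {s : Finset α} {g f : α → α} {m : α}
    (hf : f ∈ mapsOn s g) (hfm : f m = m) : IsIsolated s g m (isolate s m f) := by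
  obtain ⟨h₁, h₂⟩ := mem_mapsOn.1 hf
  refine ⟨mem_mapsOn.2 ⟨fun v hv => ?_, fun v hv => ?_⟩, ?_, fun v hv hr => ?_⟩
  · rw [isolate_of_notMem hv, h₁ v hv]
  · by_cases hr : Reach f v m
    · rw [isolate_of_reach hr]; exact h₂ v hv
    · rwa [isolate_of_not_reach hv hr]
  · rw [isolate_of_reach (Reach.refl f m), hfm]
  · exact isolate_of_not_reach hv fun h => hr ((reach_isolate_iff hv).2 h)

theorem reach_of_mem_mapsOn_outside {s : Finset α} {G f : α → α} {m v : α}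
    (hf : f ∈ mapsOn (outside s m G) G) (hv : Reach G v m) : Reach f v m :=
  Reach.of_agree (fun w hw _ => (mem_mapsOn.1 hf).1 w fun h => (mem_outside.1 h).2 hw) hv

theorem not_reach_of_mem_outside {s : Finset α} {G f : α → α} {m v : α}
    (hf : f ∈ mapsOn (outside s m G) G) (hv : v ∈ outside s m G) : ¬ Reach f v m := fun h =>
  root_notMem_outside s m G (h.mem_of_closed (p := (· ∈ outside s m G)) (mem_mapsOn.1 hf).2 hv)

/-- The self-maps with a prescribed tree at `m` are the self-maps of the other vertices. -/
theorem IsIsolated.mem_mapsOn_outside_iff {s : Finset α} {g G f : α → α} {m : α}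
    (hG : IsIsolated s g m G) :
    f ∈ mapsOn (outside s m G) G ↔ f ∈ mapsOn s g ∧ f m = m ∧ isolate s m f = G := by
  obtain ⟨hGm, hGr, hGf⟩ := hG
  obtain ⟨hG₁, hG₂⟩ := mem_mapsOn.1 hGm
  constructor
  · intro hf
    obtain ⟨h₁, h₂⟩ := mem_mapsOn.1 hf
    refine ⟨mem_mapsOn.2 ⟨fun v hv => ?_, fun v hv => ?_⟩, ?_, ?_⟩
    · rw [h₁ v fun h => hv (outside_subset _ _ _ h), hG₁ v hv]
    · by_cases hv' : v ∈ outside s m G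
      · exact outside_subset _ _ _ (h₂ v hv')
      · rw [h₁ v hv']; exact hG₂ v hv
    · rw [h₁ m (root_notMem_outside s m G), hGr]
    · funext v
      by_cases hv' : v ∈ outside s m G
      · have hvs := mem_outside.1 hv'
        rw [isolate_of_not_reach hvs.1 (not_reach_of_mem_outside hf hv'), hGf v hvs.1 hvs.2]
      · rw [← h₁ v hv']
        by_cases hvs : v ∈ s
        · refine isolate_of_reach (Reach.of_agree (h := G) (fun w hw _ => ?_) ?_)
          · exact h₁ w fun h => (mem_outside.1 h).2 hw
          · by_contra hn
            exact hv' (mem_outside.2 ⟨hvs, hn⟩)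
        · exact isolate_of_notMem hvs
  · rintro ⟨hf, _, rfl⟩
    obtain ⟨h₁, h₂⟩ := mem_mapsOn.1 hf
    refine mem_mapsOn.2 ⟨fun v hv => ?_, fun v hv => ?_⟩
    · by_cases hvs : v ∈ s
      · refine (isolate_of_reach ?_).symm
        by_contra hn
        exact hv (mem_outside.2 ⟨hvs, fun h => hn ((reach_isolate_iff hvs).1 h)⟩)
      · exact (isolate_of_notMem hvs).symm
    · obtain ⟨hvs, hr⟩ := mem_outside.1 hv
      refine mem_outside.2 ⟨h₂ v hvs, fun h => hr ((reach_isolate_iff hvs).2 ?_)⟩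
      exact ((reach_isolate_iff (h₂ v hvs)).1 h).of_apply

theorem IsIsolated.apply_notMem_outside {s : Finset α} {g G : α → α} {m : α}
    (hG : IsIsolated s g m G) (hg : ∀ v ∉ s, g v ∉ s) :
    ∀ v ∉ outside s m G, G v ∉ outside s m G := by
  intro v hv hGv
  obtain ⟨h₁, h₂⟩ := mem_outside.1 hGv
  by_cases hvs : v ∈ s
  · exact hv (mem_outside.2 ⟨hvs, fun h => h₂ (h.apply_of_fixed hG.2.1)⟩)
  · rw [(mem_mapsOn.1 hG.1).1 v hvs] at h₁
    exact hg v hvs h₁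

open scoped Classical in
theorem IsIsolated.mem_forestsOn_outside_iff {s : Finset α} {g G f : α → α} {m : α} {k : ℕ}
    (hG : IsIsolated s g m G) (hm : m ∈ s) :
    f ∈ forestsOn (outside s m G) G k ↔
      f ∈ forestsOn s g (k + 1) ∧ f m = m ∧ isolate s m f = G := by
  suffices h : ∀ _ : f ∈ mapsOn (outside s m G) G, f m = m →
      (((∀ v ∈ outside s m G, ∃ w, Reach f v w ∧ f w = w) ∧
        ((outside s m G).filter fun v => f v = v).card = k) ↔
      ((∀ v ∈ s, ∃ w, Reach f v w ∧ f w = w) ∧ (s.filter fun v => f v = v).card = k + 1)) by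
    have := hG.mem_mapsOn_outside_iff (f := f)
    rw [mem_forestsOn, mem_forestsOn]
    tauto
  intro hf hfm
  have hout : ∀ v ∈ s, v ∉ outside s m G → Reach f v m := by
    intro v hv hv'
    refine reach_of_mem_mapsOn_outside hf ?_
    by_contra hn
    exact hv' (mem_outside.2 ⟨hv, hn⟩)
  have hins : (s.filter fun v => f v = v) =
      insert m ((outside s m G).filter fun v => f v = v) := by
    ext v
    simp only [Finset.mem_filter, Finset.mem_insert]
    constructor
    · rintro ⟨hvs, hfv⟩
      by_cases hv : v ∈ outside s m G
      · exact Or.inr ⟨hv, hfv⟩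
      · exact Or.inl ((hout v hvs hv).eq_of_fixed hfv).symm
    · rintro (rfl | ⟨hv, hfv⟩)
      · exact ⟨hm, hfm⟩
      · exact ⟨outside_subset _ _ _ hv, hfv⟩
  rw [hins, Finset.card_insert_of_notMem
    (fun h => root_notMem_outside s m G (Finset.mem_filter.1 h).1), Nat.add_right_cancel_iff]
  refine and_congr_left fun _ => ⟨fun h v hv => ?_, fun h v hv => h v (outside_subset _ _ _ hv)⟩
  by_cases hv' : v ∈ outside s m G
  · exact h v hv'
  · exact ⟨m, hout v hv hv', hfm⟩

open scoped Classical in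
theorem update_self_mem_mapsOn {s : Finset α} {g f : α → α} {m : α} (hf : f ∈ mapsOn s g)
    (hm : m ∈ s) : Function.update f m m ∈ mapsOn s g := by
  obtain ⟨h₁, h₂⟩ := mem_mapsOn.1 hf
  refine mem_mapsOn.2 ⟨fun v hv => ?_, fun v hv => ?_⟩
  · rw [Function.update_of_ne (ne_of_mem_of_not_mem hm hv).symm, h₁ v hv]
  · by_cases hvm : v = m
    · subst hvm; rwa [Function.update_self]
    · rw [Function.update_of_ne hvm]; exact h₂ v hv

open scoped Classical in
theorem IsIsolated.card_forestsOn_fiber {s : Finset α} {g G : α → α} {m : α}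
    (hG : IsIsolated s g m G) (hm : m ∈ s) (k : ℕ) :
    (((forestsOn s g (k + 1)).filter fun f => f m = m).filter fun f =>
      isolate s m f = G).card = (forestsOn (outside s m G) G k).card := by
  congr 1
  ext f
  rw [hG.mem_forestsOn_outside_iff hm, Finset.mem_filter, Finset.mem_filter, and_assoc]

/-- `f` is a rooted tree on `s`. -/
def IsTreeOn (s : Finset α) (f : α → α) : Prop := ∃ r ∈ s, f r = r ∧ ∀ v ∈ s, Reach f v r

open scoped Classical in
theorem apply_max_mem_outside {s : Finset α} {g f : α → α} {m : α} (hf : f ∈ mapsOn s g)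
    (ht : IsTreeOn s f) (hm : m ∈ s) (hfm : f m ≠ m) :
    f m ∈ outside s m (isolate s m (Function.update f m m)) := by
  have hs := (mem_mapsOn.1 hf).2 m hm
  refine mem_outside.2 ⟨hs, fun h => hfm ?_⟩
  obtain ⟨r, -, hr, hall⟩ := ht
  exact (hall m hm).fixed_of_cycle hr
    ((reach_update_self_iff m _).1 ((reach_isolate_iff hs).1 h))

section Records

variable [PartialOrder α]

open scoped Classical in
/-- The records in `s`. -/
noncomputable def recordsOn (s : Finset α) (f : α → α) : Finset α :=
  s.filter fun v => ∀ w, Reach f v w → w ≤ v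

open scoped Classical in
/-- Rooted trees on `s` with exactly `k` records, extended by `g` outside `s`. -/
noncomputable def treesOn (s : Finset α) (g : α → α) (k : ℕ) : Finset (α → α) :=
  (mapsOn s g).filter fun f => IsTreeOn s f ∧ (recordsOn s f).card = k

theorem mem_treesOn {s : Finset α} {g f : α → α} {k : ℕ} :
    f ∈ treesOn s g k ↔ f ∈ mapsOn s g ∧ IsTreeOn s f ∧ (recordsOn s f).card = k := by
  simp [treesOn]

theorem mem_recordsOn {s : Finset α} {f : α → α} {v : α} :
    v ∈ recordsOn s f ↔ v ∈ s ∧ ∀ w, Reach f v w → w ≤ v := by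
  simp [recordsOn]

theorem max_mem_recordsOn {s : Finset α} {g f : α → α} {m : α} (hf : f ∈ mapsOn s g)
    (hm : m ∈ s) (hmax : ∀ v ∈ s, v ≤ m) : m ∈ recordsOn s f :=
  mem_recordsOn.2 ⟨hm, fun _ hw => hmax _ (hw.mem_of_closed (p := (· ∈ s)) (mem_mapsOn.1 hf).2 hm)⟩

open scoped Classical in
theorem IsIsolated.update_mem_treesOn_iff {s : Finset α} {g G f : α → α} {m p : α} {k : ℕ}
    (hG : IsIsolated s g m G) (hm : m ∈ s) (hmax : ∀ v ∈ s, v ≤ m)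
    (hf : f ∈ mapsOn (outside s m G) G) (hp : p ∈ outside s m G) :
    Function.update f m p ∈ treesOn s g (k + 1) ↔ f ∈ treesOn (outside s m G) G k := by
  obtain ⟨hfs, hfm, -⟩ := hG.mem_mapsOn_outside_iff.1 hf
  obtain ⟨h₁, h₂⟩ := mem_mapsOn.1 hfs
  have hpm : p ≠ m := fun h => root_notMem_outside s m G (h ▸ hp)
  have hin : ∀ v ∈ outside s m G, ∀ w, Reach (Function.update f m p) v w ↔ Reach f v w :=
    fun v hv w => reach_update_iff_of_not_reach p (not_reach_of_mem_outside hf hv) w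
  have hout : ∀ v ∈ s, v ∉ outside s m G → Reach (Function.update f m p) v m := by
    intro v hv hv'
    refine (reach_update_self_iff p v).2 (reach_of_mem_mapsOn_outside hf ?_)
    by_contra hn
    exact hv' (mem_outside.2 ⟨hv, hn⟩)
  have hmaps : Function.update f m p ∈ mapsOn s g := by
    refine mem_mapsOn.2 ⟨fun v hv => ?_, fun v hv => ?_⟩
    · rw [Function.update_of_ne (ne_of_mem_of_not_mem hm hv).symm, h₁ v hv]
    · by_cases hvm : v = m
      · subst hvm
        rw [Function.update_self]
        exact outside_subset _ _ _ hp
      · rw [Function.update_of_ne hvm]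
        exact h₂ v hv
  have htree : IsTreeOn s (Function.update f m p) ↔ IsTreeOn (outside s m G) f := by
    constructor
    · rintro ⟨r, hr, hfr, hall⟩
      have hrm : r ≠ m := by
        rintro rfl
        rw [Function.update_self] at hfr
        exact hpm hfr
      have hr' : r ∈ outside s m G := by
        by_contra h
        exact hrm ((hout r hr h).eq_of_fixed hfr).symm
      rw [Function.update_of_ne hrm] at hfr
      exact ⟨r, hr', hfr, fun v hv => (hin v hv r).1 (hall v (outside_subset _ _ _ hv))⟩
    · rintro ⟨r, hr, hfr, hall⟩
      have hrm : r ≠ m := fun h => root_notMem_outside s m G (h ▸ hr)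
      refine ⟨r, outside_subset _ _ _ hr, by rwa [Function.update_of_ne hrm], fun v hv => ?_⟩
      by_cases hv' : v ∈ outside s m G
      · exact (hin v hv' r).2 (hall v hv')
      · refine (hout v hv hv').trans (Reach.of_apply ?_)
        rw [Function.update_self]
        exact (hin p hp r).2 (hall p hp)
  have hrec : recordsOn s (Function.update f m p) = insert m (recordsOn (outside s m G) f) := by
    ext v
    rw [Finset.mem_insert]
    constructor
    · intro h
      obtain ⟨hv, hw⟩ := mem_recordsOn.1 h
      by_cases hv' : v ∈ outside s m G
      · exact Or.inr (mem_recordsOn.2 ⟨hv', fun w hr => hw w ((hin v hv' w).2 hr)⟩)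
      · exact Or.inl (le_antisymm (hmax v hv) (hw m (hout v hv hv')))
    · rintro (rfl | h)
      · exact max_mem_recordsOn hmaps hm hmax
      · obtain ⟨hv, hw⟩ := mem_recordsOn.1 h
        exact mem_recordsOn.2 ⟨outside_subset _ _ _ hv, fun w hr => hw w ((hin v hv w).1 hr)⟩
  rw [mem_treesOn, mem_treesOn, htree, hrec, Finset.card_insert_of_notMem
    (fun h => root_notMem_outside s m G (mem_recordsOn.1 h).1), Nat.add_right_cancel_iff]
  simp [hf, hmaps]

open scoped Classical in
theorem IsIsolated.card_treesOn_fiber {s : Finset α} {g G : α → α} {m : α}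
    (hG : IsIsolated s g m G) (hm : m ∈ s) (hmax : ∀ v ∈ s, v ≤ m) (k : ℕ) :
    (((treesOn s g (k + 1)).filter fun f => f m ≠ m).filter fun f =>
      isolate s m (Function.update f m m) = G).card =
      (treesOn (outside s m G) G k).card * (outside s m G).card := by
  rw [← Finset.card_product]
  refine Finset.card_nbij' (fun f => (Function.update f m m, f m))
    (fun q => Function.update q.1 m q.2) ?_ ?_ ?_ ?_
  · intro f hf
    simp only [Finset.coe_filter, Finset.mem_filter, Set.mem_ofPred_eq, Finset.coe_product,
      Set.mem_prod, Finset.mem_coe] at hf ⊢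
    obtain ⟨⟨hf, hfm⟩, rfl⟩ := hf
    obtain ⟨hfs, ht, -⟩ := mem_treesOn.1 hf
    have hp := apply_max_mem_outside hfs ht hm hfm
    refine ⟨?_, hp⟩
    rw [← hG.update_mem_treesOn_iff hm hmax (hG.mem_mapsOn_outside_iff.2
      ⟨update_self_mem_mapsOn hfs hm, Function.update_self .., rfl⟩) hp]
    simpa using hf
  · rintro ⟨f, p⟩ hq
    simp only [Finset.coe_filter, Finset.mem_filter, Set.mem_ofPred_eq, Finset.coe_product,
      Set.mem_prod, Finset.mem_coe] at hq ⊢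
    obtain ⟨hf, hp⟩ := hq
    have hfs := (mem_treesOn.1 hf).1
    obtain ⟨-, hfm, hiso⟩ := hG.mem_mapsOn_outside_iff.1 hfs
    refine ⟨⟨(hG.update_mem_treesOn_iff hm hmax hfs hp).2 hf, ?_⟩, ?_⟩
    · rw [Function.update_self]
      rintro rfl
      exact root_notMem_outside s p G hp
    · rw [Function.update_idem, Function.update_eq_self_iff.2 hfm.symm, hiso]
  · intro f _
    simp
  · rintro ⟨f, p⟩ hq
    simp only [Finset.coe_product, Set.mem_prod, Finset.mem_coe] at hq
    obtain ⟨-, hfm, -⟩ := hG.mem_mapsOn_outside_iff.1 (mem_treesOn.1 hq.1).1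
    have hself : Function.update f m m = f := Function.update_eq_self_iff.2 hfm.symm
    simp [hself]

open scoped Classical in
/-- Relating trees whose root is not the maximum to forests with the maximum as a root, given the
corresponding relation on smaller vertex sets. -/
theorem card_filter_treesOn_max_ne {s : Finset α} {g : α → α} {m : α}
    (hg : ∀ v ∉ s, g v ∉ s) (hm : m ∈ s) (hmax : ∀ v ∈ s, v ≤ m) (k c : ℕ)
    (ih : ∀ t ⊂ s, ∀ G : α → α, (∀ v ∉ t, G v ∉ t) →
      (treesOn t G k).card * t.card = c * (forestsOn t G k).card) :
    ((treesOn s g (k + 1)).filter fun f => f m ≠ m).card =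
      c * ((forestsOn s g (k + 1)).filter fun f => f m = m).card := by
  rw [Finset.card_eq_sum_card_fiberwise
      (f := fun f => isolate s m (Function.update f m m)) (t := Finset.univ)
      (fun _ _ => by simp),
    Finset.card_eq_sum_card_fiberwise (s := (forestsOn s g (k + 1)).filter fun f => f m = m)
      (f := fun f => isolate s m f) (t := Finset.univ) (fun _ _ => by simp), Finset.mul_sum]
  refine Finset.sum_congr rfl fun G _ => ?_
  by_cases hG : IsIsolated s g m G
  · rw [hG.card_treesOn_fiber hm hmax, hG.card_forestsOn_fiber hm]
    refine ih _ ⟨outside_subset _ _ _, fun h => ?_⟩ G (hG.apply_notMem_outside hg)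
    exact root_notMem_outside s m G (h hm)
  · rw [Finset.card_eq_zero.2, Finset.card_eq_zero.2, mul_zero]
    · refine Finset.filter_eq_empty_iff.2 fun f hf hfG => hG ?_
      obtain ⟨hf, hfm⟩ := Finset.mem_filter.1 hf
      exact hfG ▸ isIsolated_isolate (mem_forestsOn.1 hf).1 hfm
    · refine Finset.filter_eq_empty_iff.2 fun f hf hfG => hG ?_
      obtain ⟨hf, -⟩ := Finset.mem_filter.1 hf
      exact hfG ▸ isIsolated_isolate (update_self_mem_mapsOn (mem_treesOn.1 hf).1 hm)
        (Function.update_self ..)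

/-- If the maximum is the root, it is the only record. -/
theorem recordsOn_eq_singleton {s : Finset α} {g f : α → α} {m : α} (hf : f ∈ mapsOn s g)
    (hm : m ∈ s) (hmax : ∀ v ∈ s, v ≤ m) (ht : IsTreeOn s f) (hfm : f m = m) :
    recordsOn s f = {m} := by
  obtain ⟨r, -, hr, hall⟩ := ht
  obtain rfl : r = m := (hall m hm).eq_of_fixed hfm
  ext v
  rw [Finset.mem_singleton]
  constructor
  · intro h
    obtain ⟨hv, hw⟩ := mem_recordsOn.1 h
    exact le_antisymm (hmax v hv) (hw r (hall v hv))
  · rintro rfl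
    exact max_mem_recordsOn hf hm hmax

/-- A tree with a single record is rooted at the maximum. -/
theorem apply_max_eq_of_card_recordsOn {s : Finset α} {g f : α → α} {m : α}
    (hf : f ∈ mapsOn s g) (hm : m ∈ s) (hmax : ∀ v ∈ s, v ≤ m) (ht : IsTreeOn s f)
    (hc : (recordsOn s f).card = 1) : f m = m := by
  obtain ⟨r, hrs, hr, -⟩ := ht
  have hrr : r ∈ recordsOn s f := mem_recordsOn.2 ⟨hrs, fun w hw => (hw.eq_of_fixed hr).le⟩
  obtain rfl := Finset.card_le_one.1 hc.le r hrr m (max_mem_recordsOn hf hm hmax)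
  exact hr

open scoped Classical in
/-- `card_filter_treesOn_max_ne` for trees with at least two records. -/
theorem card_treesOn_succ {s : Finset α} {g : α → α} {m : α}
    (hg : ∀ v ∉ s, g v ∉ s) (hm : m ∈ s) (hmax : ∀ v ∈ s, v ≤ m) (k c : ℕ) (hk : k ≠ 0)
    (ih : ∀ t ⊂ s, ∀ G : α → α, (∀ v ∉ t, G v ∉ t) →
      (treesOn t G k).card * t.card = c * (forestsOn t G k).card) :
    (treesOn s g (k + 1)).card =
      c * ((forestsOn s g (k + 1)).filter fun f => f m = m).card := by
  rw [← card_filter_treesOn_max_ne hg hm hmax k c ih, Finset.filter_true_of_mem]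
  intro f hf hfm
  obtain ⟨hfs, ht, hc⟩ := mem_treesOn.1 hf
  rw [recordsOn_eq_singleton hfs hm hmax ht hfm, Finset.card_singleton] at hc
  omega

open scoped Classical in
theorem treesOn_one {s : Finset α} {g : α → α} {m : α} (hm : m ∈ s) (hmax : ∀ v ∈ s, v ≤ m) :
    treesOn s g 1 = (forestsOn s g 1).filter fun f => f m = m := by
  ext f
  rw [Finset.mem_filter, mem_treesOn, mem_forestsOn]
  constructor
  · rintro ⟨hf, ht, hc⟩
    have hfm := apply_max_eq_of_card_recordsOn hf hm hmax ht hc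
    obtain ⟨r, hrs, hr, hall⟩ := ht
    obtain rfl : r = m := (hall m hm).eq_of_fixed hfm
    refine ⟨⟨hf, fun v hv => ⟨r, hall v hv, hr⟩, Finset.card_eq_one.2 ⟨r, ?_⟩⟩, hr⟩
    ext v
    rw [Finset.mem_filter, Finset.mem_singleton]
    constructor
    · rintro ⟨hv, hfv⟩
      exact ((hall v hv).eq_of_fixed hfv).symm
    · rintro rfl
      exact ⟨hm, hr⟩
  · rintro ⟨⟨hf, hr, hc⟩, hfm⟩
    have ht : IsTreeOn s f := by
      refine ⟨m, hm, hfm, fun v hv => ?_⟩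
      obtain ⟨w, hw, hfw⟩ := hr v hv
      have hws : w ∈ s := hw.mem_of_closed (p := (· ∈ s)) (mem_mapsOn.1 hf).2 hv
      obtain rfl := Finset.card_le_one.1 hc.le w (Finset.mem_filter.2 ⟨hws, hfw⟩) m
        (Finset.mem_filter.2 ⟨hm, hfm⟩)
      exact hw
    exact ⟨hf, ht, by rw [recordsOn_eq_singleton hf hm hmax ht hfm, Finset.card_singleton]⟩

end Records

open scoped Nat in
/-- Trees with `k` records and a marked vertex are equinumerous to forests with `k` linearly
ordered roots. -/
theorem card_treesOn_mul_card [LinearOrder α] (s : Finset α) : ∀ (g : α → α) (k : ℕ),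
    1 ≤ k → (∀ v ∉ s, g v ∉ s) →
      (treesOn s g k).card * s.card = k ! * (forestsOn s g k).card := by
  induction s using Finset.strongInduction with
  | H s ih =>
    intro g k hk hg
    obtain ⟨k, rfl⟩ : ∃ j, k = j + 1 := ⟨k - 1, by omega⟩
    rcases s.eq_empty_or_nonempty with rfl | hs
    · have : forestsOn (∅ : Finset α) g (k + 1) = ∅ := by
        ext f
        simp [mem_forestsOn]
      simp [this]
    · have hm := s.max'_mem hs
      have hmax : ∀ v ∈ s, v ≤ s.max' hs := s.le_max'
      generalize s.max' hs = m at hm hmax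
      have hsym := card_mul_card_forestsOn_fixing hg hm (k + 1)
      rcases Nat.eq_zero_or_pos k with rfl | hk
      · rw [treesOn_one hm hmax, mul_comm]
        simpa using hsym
      · rw [card_treesOn_succ hg hm hmax k (k !) hk.ne' fun t ht G hG => ih t ht G k hk hG,
          mul_assoc, mul_comm _ s.card, hsym, Nat.factorial_succ]
        ring

end Forests

/-- The number of rooted labeled trees on `{1,…,n}` with exactly `k` records is
`k·(n-1)(n-2)⋯(n-k+1)·n^(n-k-1)` (stated multiplied through by `n`, so that the
exponent `n-k-1` becomes the natural number `n-k`). -/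
theorem stmt0 (n k : ℕ) (hk : 1 ≤ k) (hkn : k ≤ n) :
    Nat.card {f : Fin n → Fin n // IsTreeFun f ∧
        Nat.card {v : Fin n // IsRec f v} = k} * n =
      k * (n - 1).descFactorial (k - 1) * n ^ (n - k) := by
  have hcard : Nat.card {f : Fin n → Fin n // IsTreeFun f ∧
      Nat.card {v : Fin n // IsRec f v} = k} =
      (treesOn (Finset.univ : Finset (Fin n)) id k).card := by
    have hrec (f : Fin n → Fin n) :
        Nat.card {v : Fin n // IsRec f v} = (recordsOn Finset.univ f).card := by
      rw [← Nat.card_eq_finsetCard]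
      exact Nat.card_congr (Equiv.subtypeEquivRight fun v => by
        simp [mem_recordsOn, IsRec, Reach])
    rw [← Nat.card_eq_finsetCard]
    exact Nat.card_congr (Equiv.subtypeEquivRight fun f => by
      simp [mem_treesOn, mem_mapsOn, hrec, IsTreeOn, IsTreeFun, Reach])
  have : Nonempty (Fin n) := ⟨⟨0, by omega⟩⟩
  have h₁ := card_treesOn_mul_card (Finset.univ : Finset (Fin n)) id k hk (by simp)
  have h₂ := card_forestsOn_univ_mul (α := Fin n) k (by simpa using hkn)
  rw [Finset.card_univ, Fintype.card_fin] at h₁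
  rw [Fintype.card_fin] at h₂
  have h₃ := Nat.descFactorial_eq_factorial_mul_choose n k
  obtain ⟨n, rfl⟩ : ∃ j, n = j + 1 := ⟨n - 1, by omega⟩
  obtain ⟨k, rfl⟩ : ∃ j, k = j + 1 := ⟨k - 1, by omega⟩
  rw [Nat.succ_descFactorial_succ] at h₃
  rw [hcard, h₁]
  apply Nat.eq_of_mul_eq_mul_right (Nat.succ_pos n)
  rw [Nat.succ_eq_add_one, mul_assoc, h₂, ← mul_assoc, ← mul_assoc, ← h₃]
  simp only [Nat.add_sub_cancel]
  ring
end

section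
/- For all n, m, k with m ≥ 1 and k ≥ 1, the number of connected endofunctions on {1,...,n} of girth m having at least k+1 records equals the number of connected endofunctions on {1,...,n} of girth m+1 having at least k records. -/
def ConnFun {n : ℕ} (f : Fin n → Fin n) : Prop :=
  Nonempty (Fin n) ∧ ∀ i j, Relation.EqvGen (fun a b => f a = b) i j

noncomputable def girth {n : ℕ} (f : Fin n → Fin n) : ℕ :=
  Nat.card {x : Fin n // ∃ m, 0 < m ∧ f^[m] x = x}

/-- The number of records of `f`. -/
noncomputable def numRec {n : ℕ} (f : Fin n → Fin n) : ℕ :=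
  Nat.card {v : Fin n // IsRec f v}

namespace Endofunction

/-- The orbit of `v` under `f` passes through `w`. -/
def Reaches {α : Type*} (f : α → α) (v w : α) : Prop :=
  ∃ k, f^[k] v = w

section Reaches

variable {α : Type*} {f : α → α} {u v w : α}

theorem Reaches.refl (f : α → α) (v : α) : Reaches f v v := ⟨0, rfl⟩

theorem Reaches.trans (h₁ : Reaches f u v) (h₂ : Reaches f v w) : Reaches f u w := by
  obtain ⟨i, rfl⟩ := h₁
  obtain ⟨j, rfl⟩ := h₂
  exact ⟨j + i, Function.iterate_add_apply f j i u⟩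

theorem reaches_apply (f : α → α) (v : α) : Reaches f v (f v) := ⟨1, rfl⟩

theorem Reaches.of_apply (h : Reaches f (f v) w) : Reaches f v w := (reaches_apply f v).trans h

theorem Reaches.apply (h : Reaches f v w) : Reaches f v (f w) := h.trans (reaches_apply f w)

/-- Forward induction along an orbit. -/
theorem Reaches.forward {p : α → Prop} (h : Reaches f v w) (h₀ : p v)
    (hs : ∀ x, p x → p (f x)) : p w := by
  obtain ⟨k, rfl⟩ := h
  induction k with
  | zero => exact h₀
  | succ k ih => rw [Function.iterate_succ_apply']; exact hs _ ih

/-- Backward induction along an orbit. -/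
theorem Reaches.backward {p : α → Prop} (h : Reaches f v w) (h₀ : p w)
    (hs : ∀ x, p (f x) → p x) : p v := by
  obtain ⟨k, rfl⟩ := h
  induction k generalizing v with
  | zero => exact h₀
  | succ k ih => rw [Function.iterate_succ_apply] at h₀; exact hs _ (ih h₀)

/-- An orbit that meets `U` but starts outside of `U` has an edge entering `U`. -/
theorem Reaches.exists_entry {U : Set α} (h : Reaches f v w) (hw : w ∈ U) (hv : v ∉ U) :
    ∃ x, Reaches f v x ∧ x ∉ U ∧ f x ∈ U := by
  by_contra! H
  exact (h.forward (p := fun x => Reaches f v x ∧ x ∉ U) ⟨.refl f v, hv⟩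
    fun x hx => ⟨hx.1.apply, H x hx.1 hx.2⟩).2 hw

theorem exists_pos_iterate_iff_reaches {a : α} (h : ∀ v, Reaches f v a) (x : α) :
    (∃ m, 0 < m ∧ f^[m] x = x) ↔ Reaches f a x := by
  constructor
  · rintro ⟨p, hp, hx⟩
    obtain ⟨k, rfl⟩ := h x
    refine ⟨k * p - k, ?_⟩
    rw [← Function.iterate_add_apply, Nat.sub_add_cancel (Nat.le_mul_of_pos_right k hp)]
    exact Function.IsPeriodicPt.const_mul hx k
  · rintro ⟨i, rfl⟩
    obtain ⟨j, hj⟩ := h (f (f^[i] a))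
    refine ⟨i + (j + 1), by omega, ?_⟩
    rw [Function.iterate_add_apply, Function.iterate_succ_apply, hj]

end Reaches

variable {n : ℕ}

theorem girth_eq_ncard {f : Fin n → Fin n} {a : Fin n} (h : ∀ v, Reaches f v a) :
    girth f = {x | Reaches f a x}.ncard := by
  simp only [girth, exists_pos_iterate_iff_reaches h]
  exact Nat.card_coe_set_eq _

theorem connFun_of_reaches {f : Fin n → Fin n} {a : Fin n} (h : ∀ v, Reaches f v a) :
    ConnFun f := by
  have key (v : Fin n) : Relation.EqvGen (fun x y => f x = y) v a :=
    (h v).backward (p := fun v => Relation.EqvGen (fun x y => f x = y) v a) (.refl a)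
      fun x hx => (Relation.EqvGen.rel x (f x) rfl).trans _ _ _ hx
  exact ⟨⟨a⟩, fun i j => (key i).trans _ _ _ ((key j).symm _ _)⟩

theorem reaches_of_connFun {f : Fin n → Fin n} (hf : ConnFun f) {a : Fin n}
    (ha : ∃ m, 0 < m ∧ f^[m] a = a) (v : Fin n) : Reaches f v a := by
  have key : ∃ w, Reaches f v w ∧ Reaches f a w := by
    clear ha
    induction hf.2 v a with
    | rel x y h => exact ⟨y, ⟨1, h⟩, .refl f y⟩
    | refl x => exact ⟨x, .refl f x, .refl f x⟩
    | symm x y _ ih => obtain ⟨w, h₁, h₂⟩ := ih; exact ⟨w, h₂, h₁⟩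
    | trans x y z _ _ ih₁ ih₂ =>
      obtain ⟨w, h₁, i, hi⟩ := ih₁
      obtain ⟨w', ⟨j, hj⟩, h₂⟩ := ih₂
      refine ⟨f^[j + i] y, h₁.trans ⟨j, ?_⟩, h₂.trans ⟨i, ?_⟩⟩
      · rw [Function.iterate_add_apply, hi]
      · rw [Nat.add_comm, Function.iterate_add_apply, hj]
  obtain ⟨w, hvw, hw⟩ := key
  obtain ⟨m, hm, hma⟩ := ha
  obtain ⟨k, rfl⟩ := hw
  refine hvw.trans ⟨k * m - k, ?_⟩
  rw [← Function.iterate_add_apply, Nat.sub_add_cancel (Nat.le_mul_of_pos_right k hm)]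
  exact Function.IsPeriodicPt.const_mul hma k

/-- A connected endofunction of positive girth has a largest cyclic point. -/
theorem exists_max_cyclic_of_connFun {f : Fin n → Fin n} (hf : ConnFun f) (hg : 1 ≤ girth f) :
    ∃ a, (∀ v, Reaches f v a) ∧ ∀ v, Reaches f a v → v ≤ a := by
  obtain ⟨⟨x, hx⟩⟩ : Nonempty {x : Fin n // ∃ m, 0 < m ∧ f^[m] x = x} :=
    (Nat.card_pos_iff.1 hg).1
  obtain ⟨a, ha, hmax⟩ := (Set.toFinite {x : Fin n | ∃ m, 0 < m ∧ f^[m] x = x}).exists_maximalFor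
    id _ ⟨x, hx⟩
  have hr := reaches_of_connFun hf ha
  refine ⟨a, hr, fun v hv => ?_⟩
  by_contra! hlt
  exact absurd (hmax ((exists_pos_iterate_iff_reaches hr v).2 hv) hlt.le) (not_le.2 hlt)

/-- The position at which a point gets spliced into, or removed from, the cycle: a set `core` with
largest element `top` and a chosen element `gate`, and a `bridge` larger than `top`. -/
structure Marking (n : ℕ) where
  top : Fin n
  bridge : Fin n
  gate : Fin n
  core : Set (Fin n)
  top_mem : top ∈ core
  gate_mem : gate ∈ core
  le_top : ∀ u ∈ core, u ≤ top
  top_lt : top < bridge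

namespace Marking

variable (d : Marking n)

theorem lt_bridge {u : Fin n} (hu : u ∈ d.core) : u < d.bridge := (d.le_top u hu).trans_lt d.top_lt

theorem bridge_notMem : d.bridge ∉ d.core := fun h => (d.lt_bridge h).false

theorem ne_bridge {u : Fin n} (hu : u ∈ d.core) : u ≠ d.bridge := (d.lt_bridge hu).ne

/-- Two markings agree when their bridges, gates and cores do. -/
theorem ext_of_core {d d' : Marking n} (hb : d.bridge = d'.bridge) (hy : d.gate = d'.gate)
    (hU : d.core = d'.core) : d = d' := by
  have ht : d.top = d'.top :=
    le_antisymm (d'.le_top _ (hU ▸ d.top_mem)) (d.le_top _ (hU ▸ d'.top_mem))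
  cases d
  cases d'
  simp_all

/-- The transposition of `top` and `gate`. -/
def swap : Equiv.Perm (Fin n) := Equiv.swap d.top d.gate

@[simp] theorem swap_swap (v : Fin n) : d.swap (d.swap v) = v := Equiv.swap_apply_self _ _ _

@[simp] theorem swap_top : d.swap d.top = d.gate := Equiv.swap_apply_left _ _

@[simp] theorem swap_gate : d.swap d.gate = d.top := Equiv.swap_apply_right _ _

theorem swap_mem {u : Fin n} (hu : u ∈ d.core) : d.swap u ∈ d.core := by
  unfold swap
  rw [Equiv.swap_apply_def]
  split_ifs
  exacts [d.gate_mem, d.top_mem, hu]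

theorem swap_ne_gate {u : Fin n} (hu : u ≠ d.top) : d.swap u ≠ d.gate :=
  fun h => hu (by rw [← d.swap_swap u, h, swap_gate])

theorem swap_ne_top {u : Fin n} (hu : u ≠ d.gate) : d.swap u ≠ d.top :=
  fun h => hu (by rw [← d.swap_swap u, h, swap_top])

open Classical in
/-- Relabel `f` on the core and insert the bridge into its cycle just before the image of `top`. -/
noncomputable def splice (f : Fin n → Fin n) (v : Fin n) : Fin n :=
  if v = d.bridge then d.swap (f d.top)
  else if v ∈ d.core then if v = d.gate then d.bridge else d.swap (f (d.swap v))
  else f v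

open Classical in
/-- Remove the bridge from the cycle of `g`, undoing `splice`. -/
noncomputable def unsplice (g : Fin n → Fin n) (v : Fin n) : Fin n :=
  if v = d.bridge then d.gate
  else if v ∈ d.core then d.swap (g (if v = d.top then d.bridge else d.swap v))
  else g v

variable (f : Fin n → Fin n)

theorem splice_bridge : d.splice f d.bridge = d.swap (f d.top) := if_pos rfl

theorem splice_gate : d.splice f d.gate = d.bridge := by
  rw [splice, if_neg (d.ne_bridge d.gate_mem), if_pos d.gate_mem, if_pos rfl]

theorem splice_swap {u : Fin n} (hu : u ∈ d.core) (hut : u ≠ d.top) :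
    d.splice f (d.swap u) = d.swap (f u) := by
  rw [splice, if_neg (d.ne_bridge (d.swap_mem hu)), if_pos (d.swap_mem hu),
    if_neg (d.swap_ne_gate hut), swap_swap]

theorem splice_of_notMem {v : Fin n} (hv : v ∉ d.core) (hvb : v ≠ d.bridge) :
    d.splice f v = f v := by
  rw [splice, if_neg hvb, if_neg hv]

theorem unsplice_bridge : d.unsplice f d.bridge = d.gate := if_pos rfl

theorem unsplice_top : d.unsplice f d.top = d.swap (f d.bridge) := by
  rw [unsplice, if_neg (d.ne_bridge d.top_mem), if_pos d.top_mem, if_pos rfl]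

theorem unsplice_swap {u : Fin n} (hu : u ∈ d.core) (hug : u ≠ d.gate) :
    d.unsplice f (d.swap u) = d.swap (f u) := by
  rw [unsplice, if_neg (d.ne_bridge (d.swap_mem hu)), if_pos (d.swap_mem hu),
    if_neg (d.swap_ne_top hug), swap_swap]

theorem unsplice_of_notMem {v : Fin n} (hv : v ∉ d.core) (hvb : v ≠ d.bridge) :
    d.unsplice f v = f v := by
  rw [unsplice, if_neg hvb, if_neg hv]

variable {d f}

theorem unsplice_splice (hb : f d.bridge = d.gate) : d.unsplice (d.splice f) = f := by
  funext v
  by_cases hvb : v = d.bridge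
  · rw [hvb, unsplice_bridge, hb]
  by_cases hv : v ∈ d.core
  · by_cases hvt : v = d.top
    · rw [hvt, unsplice_top, splice_bridge, swap_swap]
    · have := d.unsplice_swap (d.splice f) (d.swap_mem hv) (d.swap_ne_gate hvt)
      rw [swap_swap] at this
      rw [this, d.splice_swap f hv hvt, swap_swap]
  · rw [d.unsplice_of_notMem _ hv hvb, d.splice_of_notMem _ hv hvb]

theorem splice_unsplice (hy : f d.gate = d.bridge) : d.splice (d.unsplice f) = f := by
  funext v
  by_cases hvb : v = d.bridge
  · rw [hvb, splice_bridge, unsplice_top, swap_swap]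
  by_cases hv : v ∈ d.core
  · by_cases hvg : v = d.gate
    · rw [hvg, splice_gate, hy]
    · have := d.splice_swap (d.unsplice f) (d.swap_mem hv) (d.swap_ne_top hvg)
      rw [swap_swap] at this
      rw [this, d.unsplice_swap f hv hvg, swap_swap]
  · rw [d.splice_of_notMem _ hv hvb, d.unsplice_of_notMem _ hv hvb]

end Marking

/-- `top` is the largest cyclic point of `f`, the core consists of the points whose orbit has
maximum `top`, and the bridge is the second smallest record, with image `gate`. -/
structure IsDetached (f : Fin n → Fin n) (d : Marking n) : Prop where
  map_bridge : f d.bridge = d.gate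
  map_core : ∀ u ∈ d.core, f u ∈ d.core
  entry : ∀ v, v ∉ d.core → f v ∈ d.core → d.bridge ≤ v
  reaches : ∀ v, Reaches f v d.top

/-- The bridge is the largest cyclic point of `g`, with cyclic predecessor `gate`, and the core
consists of the points whose orbit reaches `gate` through points below the bridge. -/
structure IsSpliced (g : Fin n → Fin n) (d : Marking n) : Prop where
  map_gate : g d.gate = d.bridge
  map_bridge : g d.bridge ∈ d.core
  map_core : ∀ u ∈ d.core, u ≠ d.gate → g u ∈ d.core
  entry : ∀ v, v ∉ d.core → g v ∈ d.core → d.bridge ≤ v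
  reaches : ∀ v, Reaches g v d.gate

variable {f g : Fin n → Fin n} {d d' : Marking n}

theorem IsDetached.isSpliced (h : IsDetached f d) : IsSpliced (d.splice f) d := by
  have hcore : ∀ u ∈ d.core, Reaches (d.splice f) (d.swap u) d.gate := fun u hu =>
    (h.reaches u).backward
      (p := fun u => u ∈ d.core → Reaches (d.splice f) (d.swap u) d.gate)
      (fun _ => by rw [d.swap_top]; exact .refl _ _)
      (fun x ih hx => by
        by_cases hxt : x = d.top
        · rw [hxt, d.swap_top]; exact .refl _ _
        · apply Reaches.of_apply
          rw [d.splice_swap f hx hxt]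
          exact ih (h.map_core x hx)) hu
  have hcore' : ∀ u ∈ d.core, Reaches (d.splice f) u d.gate := fun u hu => by
    simpa using hcore _ (d.swap_mem hu)
  have hbridge : d.splice f d.bridge ∈ d.core := by
    rw [d.splice_bridge]; exact d.swap_mem (h.map_core _ d.top_mem)
  refine ⟨d.splice_gate f, hbridge, fun u hu hug => ?_, fun v hv hgv => ?_, fun v => ?_⟩
  · have := d.splice_swap f (d.swap_mem hu) (d.swap_ne_top hug)
    rw [d.swap_swap] at this
    rw [this]
    exact d.swap_mem (h.map_core _ (d.swap_mem hu))
  · by_cases hvb : v = d.bridge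
    · exact hvb.ge
    · rw [d.splice_of_notMem f hv hvb] at hgv
      exact h.entry v hv hgv
  · refine (h.reaches v).backward (p := fun v => Reaches (d.splice f) v d.gate)
      (hcore' _ d.top_mem) fun x hx => ?_
    by_cases hxU : x ∈ d.core
    · exact hcore' x hxU
    by_cases hxb : x = d.bridge
    · rw [hxb]; exact (hcore' _ hbridge).of_apply
    · apply Reaches.of_apply
      rwa [d.splice_of_notMem f hxU hxb]

theorem IsSpliced.isDetached (h : IsSpliced g d) : IsDetached (d.unsplice g) d := by
  have hcore : ∀ u ∈ d.core, Reaches (d.unsplice g) (d.swap u) d.top := fun u hu =>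
    (h.reaches u).backward
      (p := fun u => u ∈ d.core → Reaches (d.unsplice g) (d.swap u) d.top)
      (fun _ => by rw [d.swap_gate]; exact .refl _ _)
      (fun x ih hx => by
        by_cases hxg : x = d.gate
        · rw [hxg, d.swap_gate]; exact .refl _ _
        · apply Reaches.of_apply
          rw [d.unsplice_swap g hx hxg]
          exact ih (h.map_core x hx hxg)) hu
  have hcore' : ∀ u ∈ d.core, Reaches (d.unsplice g) u d.top := fun u hu => by
    simpa using hcore _ (d.swap_mem hu)
  refine ⟨d.unsplice_bridge g, fun u hu => ?_, fun v hv hgv => ?_, fun v => ?_⟩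
  · by_cases hut : u = d.top
    · rw [hut, d.unsplice_top]; exact d.swap_mem h.map_bridge
    · have := d.unsplice_swap g (d.swap_mem hu) (d.swap_ne_gate hut)
      rw [d.swap_swap] at this
      rw [this]
      exact d.swap_mem (h.map_core _ (d.swap_mem hu) (d.swap_ne_gate hut))
  · by_cases hvb : v = d.bridge
    · exact hvb.ge
    · rw [d.unsplice_of_notMem g hv hvb] at hgv
      exact h.entry v hv hgv
  · refine (h.reaches v).backward (p := fun v => Reaches (d.unsplice g) v d.top)
      (hcore' _ d.gate_mem) fun x hx => ?_
    by_cases hxU : x ∈ d.core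
    · exact hcore' x hxU
    apply Reaches.of_apply
    by_cases hxb : x = d.bridge
    · rw [hxb, d.unsplice_bridge]; exact hcore' _ d.gate_mem
    · rwa [d.unsplice_of_notMem g hxU hxb]

theorem IsDetached.core_of_reaches (h : IsDetached f d) {u v : Fin n} (hu : u ∈ d.core)
    (huv : Reaches f u v) : v ∈ d.core :=
  huv.forward (p := (· ∈ d.core)) hu h.map_core

theorem IsSpliced.mem_core_or_eq_bridge (h : IsSpliced g d) {v : Fin n} (hv : Reaches g d.bridge v) :
    v ∈ d.core ∨ v = d.bridge := by
  refine hv.forward (p := fun v => v ∈ d.core ∨ v = d.bridge) (.inr rfl) ?_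
  rintro x (hx | rfl)
  · by_cases hxg : x = d.gate
    · right; rw [hxg, h.map_gate]
    · exact .inl (h.map_core x hx hxg)
  · exact .inl h.map_bridge

theorem IsDetached.unique (h : IsDetached f d) (h' : IsDetached f d') : d = d' := by
  have htop {d d' : Marking n} (h : IsDetached f d) (h' : IsDetached f d') : d.top ≤ d'.top :=
    d'.le_top _ (h'.core_of_reaches d'.top_mem (h.reaches _))
  have ht : d.top = d'.top := le_antisymm (htop h h') (htop h' h)
  have hcore {d d' : Marking n} (h : IsDetached f d) (h' : IsDetached f d')
      (ht : d.top = d'.top) : d.core ⊆ d'.core := by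
    intro u hu
    by_contra hu'
    obtain ⟨x, hx, hxU, hfx⟩ := (h'.reaches u).exists_entry d'.top_mem hu'
    exact absurd ((h'.entry x hxU hfx).trans (d.le_top x (h.core_of_reaches hu hx)))
      (not_le.2 (ht ▸ d'.top_lt))
  have hU : d.core = d'.core := (hcore h h' ht).antisymm (hcore h' h ht.symm)
  have hb : d.bridge = d'.bridge := by
    apply le_antisymm
    · exact h.entry _ (hU ▸ d'.bridge_notMem) (by rw [h'.map_bridge, hU]; exact d'.gate_mem)
    · exact h'.entry _ (hU ▸ d.bridge_notMem) (by rw [h.map_bridge, ← hU]; exact d.gate_mem)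
  exact Marking.ext_of_core hb (by rw [← h.map_bridge, ← h'.map_bridge, hb]) hU

theorem IsSpliced.reaches_bridge (h : IsSpliced g d) (v : Fin n) : Reaches g v d.bridge :=
  h.map_gate ▸ (h.reaches v).apply

/-- From the core, the gate is reached within the core. -/
theorem IsSpliced.core_induction (h : IsSpliced g d) {p : Fin n → Prop} (h₀ : p d.gate)
    (hs : ∀ x ∈ d.core, p (g x) → p x) {u : Fin n} (hu : u ∈ d.core) : p u :=
  (h.reaches u).backward (p := fun u => u ∈ d.core → p u) (fun _ => h₀)
    (fun x ih hx => by
      by_cases hxg : x = d.gate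
      · rwa [hxg]
      · exact hs x hx (ih (h.map_core x hx hxg))) hu

theorem IsSpliced.unique (h : IsSpliced g d) (h' : IsSpliced g d') : d = d' := by
  have hle {d d' : Marking n} (h : IsSpliced g d) (h' : IsSpliced g d') : d.bridge ≤ d'.bridge :=
    (h'.mem_core_or_eq_bridge (h.reaches_bridge _)).elim (fun hx => (d'.lt_bridge hx).le) le_of_eq
  have hb : d.bridge = d'.bridge := le_antisymm (hle h h') (hle h' h)
  have hy : d.gate = d'.gate := by
    have hper {d : Marking n} (h : IsSpliced g d) : d.gate ∈ Function.periodicPts g :=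
      (exists_pos_iterate_iff_reaches h.reaches _).2 (.refl _ _)
    exact (Function.bijOn_periodicPts g).injOn (hper h) (hper h')
      (by rw [h.map_gate, h'.map_gate, hb])
  have hcore {d d' : Marking n} (h : IsSpliced g d) (h' : IsSpliced g d')
      (hb : d.bridge = d'.bridge) (hy : d.gate = d'.gate) : d.core ⊆ d'.core := fun u hu =>
    h.core_induction (p := (· ∈ d'.core)) (hy ▸ d'.gate_mem) (fun x hx hgx => by
      by_contra hx'
      exact absurd (h'.entry x hx' hgx) (not_le.2 (hb ▸ d.lt_bridge hx))) hu
  exact Marking.ext_of_core hb hy ((hcore h h' hb hy).antisymm (hcore h' h hb.symm hy.symm))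

theorem exists_isDetached (hf : ConnFun f) (hg : 1 ≤ girth f) (hr : 2 ≤ numRec f) :
    ∃ d, IsDetached f d := by
  obtain ⟨a, ha, hmax⟩ := exists_max_cyclic_of_connFun hf hg
  let U : Set (Fin n) := {v | ∀ w, Reaches f v w → w ≤ a}
  have haU : a ∈ U := hmax
  obtain ⟨r, hrec, hra⟩ : ∃ r, IsRec f r ∧ r ≠ a := by
    by_contra! H
    have : Subsingleton {v : Fin n // IsRec f v} :=
      ⟨fun x y => Subtype.ext ((H x x.2).trans (H y y.2).symm)⟩
    have := Finite.card_le_one_iff_subsingleton.2 this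
    unfold numRec at hr
    omega
  have hrU : r ∉ U := fun hrU => by
    obtain ⟨k, hk⟩ := ha r
    exact hra (le_antisymm (hrU r (.refl f r)) (hk ▸ hrec k))
  obtain ⟨x, -, hxU, hfx⟩ := (ha r).exists_entry haU hrU
  obtain ⟨b, ⟨hbU, hfb⟩, hmin⟩ :=
    (Set.toFinite {v : Fin n | v ∉ U ∧ f v ∈ U}).exists_minimalFor id _ ⟨x, hxU, hfx⟩
  have hab : a < b := by
    by_contra! hba
    refine hbU ?_
    rintro w ⟨k, rfl⟩
    cases k with
    | zero => exact hba
    | succ k => exact hfb _ ⟨k, (Function.iterate_succ_apply f k b).symm⟩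
  refine ⟨⟨a, b, f b, U, haU, hfb, fun u hu => hu u (.refl f u), hab⟩, rfl,
    fun u hu w hw => hu w hw.of_apply, fun v hv hfv => ?_, ha⟩
  exact (le_total v b).elim (fun h => hmin ⟨hv, hfv⟩ h) id

theorem exists_isSpliced (hg : ConnFun g) (hgirth : 2 ≤ girth g) : ∃ d, IsSpliced g d := by
  obtain ⟨b, hb, hmax⟩ := exists_max_cyclic_of_connFun hg (by omega)
  have hper := (exists_pos_iterate_iff_reaches hb b).2 (.refl g b)
  classical
  obtain ⟨hp, hpb⟩ := Nat.find_spec hper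
  have hmin : ∀ i, 0 < i → i < Nat.find hper → g^[i] b ≠ b :=
    fun i hi hip hib => Nat.find_min hper hip ⟨hi, hib⟩
  generalize Nat.find hper = p at hp hpb hmin
  have hp2 : 2 ≤ p := by
    by_contra! hlt
    obtain rfl : p = 1 := by omega
    rw [girth_eq_ncard hb] at hgirth
    have : {x | Reaches g b x} ⊆ {b} := fun x hx =>
      hx.forward (p := (· ∈ ({b} : Set (Fin n)))) rfl (by rintro _ rfl; exact hpb)
    have := (Set.ncard_le_ncard this).trans_eq (Set.ncard_singleton b)
    omega
  obtain ⟨q, rfl⟩ : ∃ q, p = q + 2 := ⟨p - 2, by omega⟩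
  have hlt : ∀ i, i ≤ q → g^[i] (g b) < b := fun i hi => by
    rw [← Function.iterate_succ_apply]
    exact (hmax _ ⟨i + 1, rfl⟩).lt_of_ne (hmin _ (by omega) (by omega))
  let U : Set (Fin n) := {v | ∃ k, g^[k] v = g^[q] (g b) ∧ ∀ i ≤ k, g^[i] v < b}
  have hyU : g^[q] (g b) ∈ U := ⟨0, rfl, fun i hi => by
    obtain rfl : i = 0 := by omega
    exact hlt q le_rfl⟩
  have hUb : ∀ u ∈ U, u < b := fun u ⟨k, _, hk⟩ => hk 0 (by omega)
  have hgy : g (g^[q] (g b)) = b := by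
    rw [← Function.iterate_succ_apply' g, ← Function.iterate_succ_apply g]; exact hpb
  obtain ⟨a, haU, hamax⟩ := (Set.toFinite U).exists_maximalFor id _ ⟨_, hyU⟩
  refine ⟨⟨a, b, g^[q] (g b), U, haU, hyU,
    fun u hu => (le_total a u).elim (fun h => hamax hu h) id, hUb a haU⟩,
    hgy, ⟨q, rfl, hlt⟩, ?_, ?_, fun v => (hb v).trans ⟨q + 1, Function.iterate_succ_apply _ _ _⟩⟩
  · rintro u ⟨k, hk, hki⟩ hu
    cases k with
    | zero => exact absurd hk hu
    | succ k => exact ⟨k, hk, fun i hi => hki (i + 1) (by omega)⟩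
  · rintro v hv ⟨k, hk, hki⟩
    change b ≤ v
    by_contra! hvb
    refine hv ⟨k + 1, hk, fun i hi => ?_⟩
    cases i with
    | zero => exact hvb
    | succ i => exact hki i (by omega)

theorem IsDetached.girth_splice (h : IsDetached f d) : girth (d.splice f) = girth f + 1 := by
  have hs := h.isSpliced
  have hset : {x | Reaches (d.splice f) d.bridge x} =
      insert d.bridge (d.swap '' {x | Reaches f d.top x}) := by
    apply Set.Subset.antisymm
    · intro x hx
      refine hx.forward
        (p := (· ∈ insert d.bridge (d.swap '' {x | Reaches f d.top x}))) (.inl rfl) ?_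
      rintro _ (rfl | ⟨x, hx, rfl⟩)
      · exact .inr ⟨_, reaches_apply f d.top, (d.splice_bridge f).symm⟩
      · by_cases hxt : x = d.top
        · left; rw [hxt, d.swap_top, d.splice_gate]
        · exact .inr ⟨f x, Reaches.apply hx,
            (d.splice_swap f (h.core_of_reaches d.top_mem hx) hxt).symm⟩
    · rintro _ (rfl | ⟨x, hx, rfl⟩)
      · exact .refl _ _
      · refine (Reaches.forward hx
          (p := fun x => x ∈ d.core ∧ Reaches (d.splice f) d.bridge (d.swap x))
          ⟨d.top_mem, by rw [d.swap_top]; exact hs.reaches _⟩ fun x hx => ?_).2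
        refine ⟨h.map_core x hx.1, ?_⟩
        by_cases hxt : x = d.top
        · rw [hxt, ← d.splice_bridge]; exact reaches_apply _ _
        · rw [← d.splice_swap f hx.1 hxt]; exact hx.2.apply
  rw [girth_eq_ncard hs.reaches_bridge, girth_eq_ncard h.reaches, hset,
    Set.ncard_insert_of_notMem, Set.ncard_image_of_injective _ d.swap.injective]
  rintro ⟨x, hx, hxb⟩
  exact d.ne_bridge (d.swap_mem (h.core_of_reaches d.top_mem hx)) hxb

/-- Changing `f` on a set that is closed under the new map and bounded by `v` keeps `v` a record. -/
theorem isRec_of_eqOn_compl {W : Set (Fin n)} {v : Fin n} (hv : IsRec f v)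
    (hfg : ∀ x, x ∉ W → g x = f x) (hW : ∀ x ∈ W, g x ∈ W) (hle : ∀ x ∈ W, x ≤ v) : IsRec g v := by
  have key : ∀ w, Reaches g v w → w ∈ W ∨ Reaches f v w := fun w hw => by
    refine hw.forward (p := fun w => w ∈ W ∨ Reaches f v w) (.inr (.refl f v)) fun x hx => ?_
    by_cases hxW : x ∈ W
    · exact .inl (hW x hxW)
    · rw [hfg x hxW]
      exact .inr (hx.resolve_left hxW).apply
  intro k
  obtain h | ⟨i, hi⟩ := key _ ⟨k, rfl⟩
  · exact hle _ h
  · exact hi ▸ hv i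

/-- A record outside of the core is at least the bridge. -/
theorem bridge_le_of_isRec (hent : ∀ v, v ∉ d.core → f v ∈ d.core → d.bridge ≤ v)
    {v w : Fin n} (hw : w ∈ d.core) (hvw : Reaches f v w) (hv : IsRec f v) (hvU : v ∉ d.core) :
    d.bridge ≤ v := by
  obtain ⟨x, ⟨k, rfl⟩, hxU, hfx⟩ := hvw.exists_entry hw hvU
  exact (hent _ hxU hfx).trans (hv k)

theorem IsDetached.isRec_iff (h : IsDetached f d) (v : Fin n) :
    IsRec f v ↔ v = d.top ∨ IsRec (d.splice f) v := by
  have hs := h.isSpliced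
  have hfg : ∀ x, x ∉ insert d.bridge d.core → d.splice f x = f x := fun x hx =>
    d.splice_of_notMem f (fun h => hx (.inr h)) (fun h => hx (.inl h))
  have hle : d.bridge ≤ v → ∀ x ∈ insert d.bridge d.core, x ≤ v := by
    rintro hv x (rfl | hx)
    exacts [hv, (d.lt_bridge hx).le.trans hv]
  have hWf : ∀ x ∈ insert d.bridge d.core, f x ∈ insert d.bridge d.core := by
    rintro x (rfl | hx)
    · rw [h.map_bridge]; exact .inr d.gate_mem
    · exact .inr (h.map_core x hx)
  have hWg : ∀ x ∈ insert d.bridge d.core, d.splice f x ∈ insert d.bridge d.core := by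
    rintro x (rfl | hx)
    · exact .inr hs.map_bridge
    · by_cases hxg : x = d.gate
      · rw [hxg, hs.map_gate]; exact .inl rfl
      · exact .inr (hs.map_core x hx hxg)
  constructor
  · intro hv
    by_cases hvU : v ∈ d.core
    · obtain ⟨k, hk⟩ := h.reaches v
      exact .inl (le_antisymm (d.le_top v hvU) (hk ▸ hv k))
    · exact .inr (isRec_of_eqOn_compl hv hfg hWg
        (hle (bridge_le_of_isRec h.entry d.top_mem (h.reaches v) hv hvU)))
  · rintro (rfl | hv)
    · exact fun k => d.le_top _ (h.core_of_reaches d.top_mem ⟨k, rfl⟩)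
    · have hvU : v ∉ d.core := fun hvU => by
        obtain ⟨k, hk⟩ := hs.reaches_bridge v
        exact absurd (hk ▸ hv k) (not_le.2 (d.lt_bridge hvU))
      exact isRec_of_eqOn_compl hv (fun x hx => (hfg x hx).symm) hWf
        (hle (bridge_le_of_isRec hs.entry d.gate_mem (hs.reaches v) hv hvU))

theorem IsDetached.numRec_splice (h : IsDetached f d) : numRec f = numRec (d.splice f) + 1 := by
  have hset : {v | IsRec f v} = insert d.top {v | IsRec (d.splice f) v} :=
    Set.ext h.isRec_iff
  have hnot : d.top ∉ {v | IsRec (d.splice f) v} := fun hv => by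
    obtain ⟨k, hk⟩ := h.isSpliced.reaches_bridge d.top
    exact absurd (hk ▸ hv k) (not_le.2 d.top_lt)
  have := Set.ncard_insert_of_notMem hnot
  rwa [← hset] at this

end Endofunction

open Endofunction in
/-- Connected endofunctions of girth `m` with at least `k+1` records are
equinumerous with connected endofunctions of girth `m+1` with at least `k` records. -/
theorem stmt5 (n m k : ℕ) (hm : 1 ≤ m) (hk : 1 ≤ k) :
    Nat.card {f : Fin n → Fin n // ConnFun f ∧ girth f = m ∧ k + 1 ≤ numRec f} =
      Nat.card {f : Fin n → Fin n // ConnFun f ∧ girth f = m + 1 ∧ k ≤ numRec f} := by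
  have hex (f : {f : Fin n → Fin n // ConnFun f ∧ girth f = m ∧ k + 1 ≤ numRec f}) :
      ∃ d, IsDetached f.1 d :=
    exists_isDetached f.2.1 (by rw [f.2.2.1]; exact hm) (by have := f.2.2.2; omega)
  choose D hD using hex
  refine Nat.card_eq_of_bijective (fun f => ⟨(D f).splice f.1,
    connFun_of_reaches (hD f).isSpliced.reaches, by rw [(hD f).girth_splice, f.2.2.1],
    by have := (hD f).numRec_splice; have := f.2.2.2; omega⟩) ⟨?_, ?_⟩
  · intro f f' hff
    have hff : (D f).splice f.1 = (D f').splice f'.1 := congrArg Subtype.val hff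
    have hd : D f = D f' := (hD f).isSpliced.unique (hff ▸ (hD f').isSpliced)
    apply Subtype.ext
    rw [← Marking.unsplice_splice (hD f).map_bridge, hff, hd,
      Marking.unsplice_splice (hD f').map_bridge]
  · rintro ⟨g, hg, hgirth, hrec⟩
    obtain ⟨d, hd⟩ := exists_isSpliced hg (by omega)
    have hdet := hd.isDetached
    have hgd := Marking.splice_unsplice hd.map_gate
    have h₁ := hdet.girth_splice
    have h₂ := hdet.numRec_splice
    rw [hgd] at h₁ h₂
    refine ⟨⟨d.unsplice g, connFun_of_reaches hdet.reaches, by omega, by omega⟩, Subtype.ext ?_⟩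
    change (D _).splice (d.unsplice g) = g
    rw [(hD _).unique hdet, hgd]
end

section
/- The number of rooted labeled trees of order n in which the set of records induces a connected subgraph equals the number of cyclic sequences of unrooted labeled trees whose label sets partition {1,...,n}. -/
open scoped Classical

/-- The undirected graph of the tree with parent map `f`. -/
def treeGraph {n : ℕ} (f : Fin n → Fin n) : SimpleGraph (Fin n) :=
  SimpleGraph.fromRel (fun a b => f a = b)

theorem SimpleGraph.Reachable.invariant {V : Type*} {G : SimpleGraph V} {P : V → Prop}
    (hP : ∀ a b, G.Adj a b → P a → P b) {u v : V} (h : G.Reachable u v) (hu : P u) : P v := by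
  obtain ⟨p⟩ := h
  induction p with
  | nil => exact hu
  | cons hadj _ ih => exact ih (hP _ _ hadj hu)

/-- The self-maps all of whose orbits reach a fixed point that is at least the starting point:
parent maps of rooted forests in which each root is the largest label of its tree. -/
def IsMaxRootedForest {n : ℕ} (h : Fin n → Fin n) : Prop :=
  ∀ v, ∃ k, h (h^[k] v) = h^[k] v ∧ v ≤ h^[k] v

/-- The parent map of the forest obtained by cutting the edges above all records. -/
noncomputable def cutRecords {n : ℕ} (f : Fin n → Fin n) : Fin n → Fin n :=
  fun v => if IsRec f v then v else f v

section Iterate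

variable {n : ℕ} {h : Fin n → Fin n}

theorem treeGraph_adj {a b : Fin n} :
    (treeGraph h).Adj a b ↔ a ≠ b ∧ (h a = b ∨ h b = a) := Iff.rfl

theorem eq_of_iterate_eq_fixed {v a b : Fin n} {j k : ℕ} (hj : h^[j] v = a) (ha : h a = a)
    (hk : h^[k] v = b) (hb : h b = b) : a = b := by
  have h1 : h^[k + j] v = a := by
    rw [Function.iterate_add_apply, hj, Function.iterate_fixed ha]
  have h2 : h^[j + k] v = b := by
    rw [Function.iterate_add_apply, hk, Function.iterate_fixed hb]
  rw [← h1, ← h2, add_comm]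

theorem exists_iterate_eq_of_reachable {u v : Fin n} (hu : h u = u)
    (hr : (treeGraph h).Reachable u v) : ∃ k, h^[k] v = u := by
  refine hr.invariant (P := fun w => ∃ k, h^[k] w = u) ?_ ⟨0, rfl⟩
  rintro a b ⟨-, hab | hba⟩ ⟨k, hk⟩
  · refine ⟨k, ?_⟩
    rw [← hab, ← Function.iterate_succ_apply, Function.iterate_succ_apply', hk, hu]
  · exact ⟨k + 1, by rw [Function.iterate_succ_apply, hba, hk]⟩

theorem reachable_iterate (v : Fin n) (k : ℕ) : (treeGraph h).Reachable v (h^[k] v) := by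
  induction k with
  | zero => rfl
  | succ k ih =>
    rw [Function.iterate_succ_apply']
    by_cases hk : h^[k] v = h (h^[k] v)
    · rwa [← hk]
    · exact ih.trans (SimpleGraph.Adj.reachable ⟨hk, Or.inl rfl⟩)

theorem IsMaxRootedForest.iterate_fixed (H : IsMaxRootedForest h) {v : Fin n} {k : ℕ}
    (hk : h^[k + 1] v = v) : h v = v := by
  obtain ⟨j, hj, -⟩ := H v
  have hper : ∀ m, h^[m * (k + 1)] v = v := by
    intro m
    rw [mul_comm, Function.iterate_mul, Function.iterate_fixed hk]
  have hle : j ≤ j * (k + 1) := Nat.le_mul_of_pos_right _ (Nat.succ_pos k)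
  have : h^[j * (k + 1)] v = h^[j] v := by
    obtain ⟨d, hd⟩ := Nat.exists_eq_add_of_le' hle
    rw [hd, Function.iterate_add_apply, Function.iterate_fixed hj]
  rw [hper] at this
  rw [this, hj]

theorem IsMaxRootedForest.le_of_reachable (H : IsMaxRootedForest h) {u v : Fin n}
    (hu : h u = u) (hr : (treeGraph h).Reachable u v) : v ≤ u := by
  obtain ⟨j, hj⟩ := exists_iterate_eq_of_reachable hu hr
  obtain ⟨k, hk, hle⟩ := H v
  rwa [eq_of_iterate_eq_fixed hj hu rfl hk]

theorem IsMaxRootedForest.isAcyclic (H : IsMaxRootedForest h) : (treeGraph h).IsAcyclic := by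
  have key : ∀ v, h v ≠ v → (treeGraph h).IsBridge s(v, h v) := by
    intro v hv
    rw [SimpleGraph.isBridge_iff]
    intro hr
    obtain ⟨k, hk⟩ := hr.invariant (P := fun w => ∃ k, h^[k] w = v) (by
      intro a b hab hk
      obtain ⟨k, hk⟩ := hk
      rw [SimpleGraph.deleteEdges_adj] at hab
      obtain ⟨⟨-, rfl | hba⟩, hne⟩ := hab
      · cases k with
        | zero =>
          obtain rfl : a = v := hk
          simp at hne
        | succ k => exact ⟨k, hk⟩
      · exact ⟨k + 1, by rw [Function.iterate_succ_apply, hba, hk]⟩) ⟨0, rfl⟩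
    exact hv (H.iterate_fixed (k := k) hk)
  rw [SimpleGraph.isAcyclic_iff_forall_adj_isBridge]
  rintro a b ⟨hne, rfl | rfl⟩
  · exact key a hne.symm
  · rw [Sym2.eq_swap]
    exact key b hne

theorem IsMaxRootedForest.fixed_of_treeGraph_eq {g : Fin n → Fin n} (H : IsMaxRootedForest h)
    (K : IsMaxRootedForest g) (he : treeGraph h = treeGraph g) {v : Fin n} (hv : h v = v) :
    g v = v := by
  obtain ⟨k, hk, hle⟩ := K v
  have hr := reachable_iterate (h := g) v k
  rw [← he] at hr
  have := le_antisymm hle (H.le_of_reachable hv hr)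
  rwa [← this] at hk

theorem IsMaxRootedForest.eq_of_treeGraph_eq {g : Fin n → Fin n} (H : IsMaxRootedForest h)
    (K : IsMaxRootedForest g) (he : treeGraph h = treeGraph g) : h = g := by
  have key : ∀ k v, h (h^[k] v) = h^[k] v → h v = g v := by
    intro k
    induction k with
    | zero =>
      intro v hv
      exact hv.trans (H.fixed_of_treeGraph_eq K he hv).symm
    | succ k ih =>
      intro v hv
      by_cases hf : h v = v
      · rw [H.fixed_of_treeGraph_eq K he hf, hf]
      · have hadj : (treeGraph h).Adj v (h v) := ⟨fun e => hf e.symm, Or.inl rfl⟩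
        rw [he] at hadj
        rcases hadj.2 with e | e
        · exact e.symm
        · rw [← ih (h v) hv] at e
          exact absurd (H.iterate_fixed (k := 1) e) hf
  funext v
  obtain ⟨k, hk, -⟩ := H v
  exact key k v hk

end Iterate

theorem exists_isMaxRootedForest_treeGraph_eq {n : ℕ} {G : SimpleGraph (Fin n)}
    (hG : G.IsAcyclic) : ∃ h, IsMaxRootedForest h ∧ treeGraph h = G := by
  have hmax : ∀ c : G.ConnectedComponent, ∃ m, G.connectedComponentMk m = c ∧
      ∀ v, G.connectedComponentMk v = c → v ≤ m := by
    intro c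
    obtain ⟨m, hm⟩ := (Set.toFinite {v | G.connectedComponentMk v = c}).exists_maximal c.exists_rep
    refine ⟨m, hm.1, fun v hv => ?_⟩
    exact (le_total v m).elim id fun h => hm.2 hv h
  choose m hm1 hm2 using hmax
  let ρ : Fin n → Fin n := fun v => m (G.connectedComponentMk v)
  have hρ : ∀ v, G.Reachable v (ρ v) := fun v => (SimpleGraph.ConnectedComponent.exact (hm1 _)).symm
  have hnext : ∀ v, ∃ w, if v = ρ v then w = v else
      G.Adj v w ∧ G.dist w (ρ v) + 1 = G.dist v (ρ v) := by
    intro v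
    by_cases hv : v = ρ v
    · exact ⟨v, by simp [← hv]⟩
    · simp only [hv, if_false]
      obtain ⟨p, hp⟩ := (hρ v).exists_walk_length_eq_dist
      generalize ρ v = u at *
      cases p with
      | nil => exact absurd rfl hv
      | @cons _ w _ hadj q =>
        refine ⟨w, hadj, ?_⟩
        have h1 := SimpleGraph.dist_le q
        obtain ⟨q', hq'⟩ := (SimpleGraph.Walk.reachable q).exists_walk_length_eq_dist
        have h2 := SimpleGraph.dist_le (SimpleGraph.Walk.cons hadj q')
        simp only [SimpleGraph.Walk.length_cons] at hp h2
        omega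
  choose h hh using hnext
  have hfix : ∀ v, v = ρ v → h v = v := fun v hv => by simpa [← hv] using hh v
  have hstep : ∀ v, v ≠ ρ v → G.Adj v (h v) ∧ G.dist (h v) (ρ v) + 1 = G.dist v (ρ v) :=
    fun v hv => by simpa [hv] using hh v
  have hρh : ∀ v, ρ (h v) = ρ v := by
    intro v
    by_cases hv : v = ρ v
    · rw [hfix v hv]
    · exact congrArg m (SimpleGraph.ConnectedComponent.sound (hstep v hv).1.symm.reachable)
  have hreach : ∀ d v, G.dist v (ρ v) = d → ∃ k, h^[k] v = ρ v := by
    intro d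
    induction d with
    | zero =>
      intro v hv
      exact ⟨0, (hρ v).dist_eq_zero_iff.1 hv⟩
    | succ d ih =>
      intro v hv
      have hne : v ≠ ρ v := by
        intro e
        rw [← e, SimpleGraph.dist_self] at hv
        omega
      obtain ⟨k, hk⟩ := ih (h v) (by have := (hstep v hne).2; rw [hρh]; omega)
      exact ⟨k + 1, by rw [Function.iterate_succ_apply, hk, hρh]⟩
  have hle : treeGraph h ≤ G := by
    have : ∀ a, a ≠ h a → G.Adj a (h a) := fun a ha =>
      (hstep a fun e => ha (hfix a e).symm).1
    rintro a b ⟨hne, rfl | rfl⟩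
    · exact this a hne
    · exact (this b hne.symm).symm
  refine ⟨h, ?_, le_antisymm hle ?_⟩
  · intro v
    obtain ⟨k, hk⟩ := hreach _ v rfl
    refine ⟨k, ?_, ?_⟩
    · rw [hk]
      refine hfix _ (congrArg m ?_)
      exact (hm1 _).symm
    · rw [hk]
      exact hm2 _ _ rfl
  · intro a b hab
    by_contra hnot
    have hρab : ρ a = ρ b := congrArg m (SimpleGraph.ConnectedComponent.sound hab.reachable)
    have hr : (treeGraph h).Reachable a b := by
      obtain ⟨j, hj⟩ := hreach _ a rfl
      obtain ⟨k, hk⟩ := hreach _ b rfl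
      have h1 := reachable_iterate (h := h) a j
      have h2 := reachable_iterate (h := h) b k
      rw [hj, hρab] at h1
      rw [hk] at h2
      exact h1.trans h2.symm
    refine SimpleGraph.isBridge_iff.1
      (SimpleGraph.isAcyclic_iff_forall_adj_isBridge.1 hG hab) (hr.mono ?_)
    intro x y hxy
    rw [SimpleGraph.deleteEdges_adj]
    refine ⟨hle hxy, fun hmem => hnot ?_⟩
    rcases Sym2.eq_iff.1 (Set.mem_singleton_iff.1 hmem) with ⟨rfl, rfl⟩ | ⟨rfl, rfl⟩
    · exact hxy
    · exact hxy.symm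

/-- Forests of unrooted trees are the same as forests rooted at the largest labels. -/
noncomputable def maxRootedForestEquiv (n : ℕ) :
    {h : Fin n → Fin n // IsMaxRootedForest h} ≃ {G : SimpleGraph (Fin n) // G.IsAcyclic} :=
  Equiv.ofBijective (fun h => ⟨treeGraph h.1, h.2.isAcyclic⟩)
    ⟨fun h g e => Subtype.ext (h.2.eq_of_treeGraph_eq g.2 (congrArg Subtype.val e)),
      fun G => by
        obtain ⟨h, hh, e⟩ := exists_isMaxRootedForest_treeGraph_eq G.2
        exact ⟨⟨h, hh⟩, Subtype.ext e⟩⟩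

theorem IsMaxRootedForest.card_connectedComponent {n : ℕ} {h : Fin n → Fin n}
    (H : IsMaxRootedForest h) :
    Nat.card (treeGraph h).ConnectedComponent = (Finset.univ.filter fun v => h v = v).card := by
  rw [← Fintype.card_subtype, ← Nat.card_eq_fintype_card, eq_comm]
  refine Nat.card_eq_of_bijective
    (fun v : {v // h v = v} => (treeGraph h).connectedComponentMk v.1) ⟨fun u v e => ?_, ?_⟩
  · have hr := SimpleGraph.ConnectedComponent.exact e
    exact Subtype.ext (le_antisymm (H.le_of_reachable v.2 hr.symm) (H.le_of_reachable u.2 hr))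
  · refine SimpleGraph.ConnectedComponent.ind fun v => ?_
    obtain ⟨k, hk, -⟩ := H v
    exact ⟨⟨h^[k] v, hk⟩, SimpleGraph.ConnectedComponent.sound (reachable_iterate v k).symm⟩

theorem card_transitive_perm {α : Type*} [Finite α] [Nonempty α] :
    Nat.card {σ : Equiv.Perm α // ∀ c c', ∃ i : ℕ, (σ ^ i) c = c'} =
      (Nat.card α - 1).factorial := by
  have := Fintype.ofFinite α
  rcases subsingleton_or_nontrivial α with hα | hα
  · have : Unique {σ : Equiv.Perm α // ∀ c c', ∃ i : ℕ, (σ ^ i) c = c'} :=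
      { default := ⟨1, fun c c' => ⟨0, Subsingleton.elim _ _⟩⟩
        uniq := fun σ => Subsingleton.elim _ _ }
    rw [Nat.card_unique, Nat.card_of_subsingleton (Classical.arbitrary α)]
    rfl
  · have hiff : ∀ σ : Equiv.Perm α, (∀ c c', ∃ i : ℕ, (σ ^ i) c = c') ↔
        σ.cycleType = {Fintype.card α} := by
      intro σ
      constructor
      · intro hσ
        have hmove : ∀ c, σ c ≠ c := by
          intro c hc
          obtain ⟨c', hc'⟩ := exists_ne c
          obtain ⟨i, hi⟩ := hσ c c'
          exact hc' (hi.symm.trans (Equiv.Perm.pow_apply_eq_self_of_apply_eq_self hc i))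
        have hcyc : σ.IsCycle := by
          refine ⟨Classical.arbitrary α, hmove _, fun c _ => ?_⟩
          obtain ⟨i, hi⟩ := hσ (Classical.arbitrary α) c
          exact ⟨i, by simpa using hi⟩
        have hsupp : σ.support = Finset.univ := by
          ext c
          simp [hmove c]
        rw [hcyc.cycleType, hsupp, Finset.card_univ]
      · intro hσ
        have hcyc : σ.IsCycle := by
          rw [← Equiv.Perm.card_cycleType_eq_one, hσ, Multiset.card_singleton]
        have hsupp : σ.support = Finset.univ := by
          rw [← Finset.card_eq_iff_eq_univ, ← Equiv.Perm.sum_cycleType, hσ,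
            Multiset.sum_singleton]
        have hmove : ∀ c, σ c ≠ c := fun c =>
          Equiv.Perm.mem_support.1 (hsupp ▸ Finset.mem_univ c)
        exact fun c c' => hcyc.exists_pow_eq (hmove c) (hmove c')
    simp_rw [hiff]
    rw [Nat.card_eq_fintype_card, Fintype.card_subtype, Nat.card_eq_fintype_card]
    have := Equiv.Perm.card_of_cycleType_singleton (α := α) (n := Fintype.card α)
      Fintype.one_lt_card le_rfl
    rw [Nat.choose_self, mul_one] at this
    rw [← this]

theorem prod_card_filter_lt {α : Type*} [LinearOrder α] (s : Finset α) :
    ∏ v ∈ s, max 1 (s.filter (· < v)).card = (s.card - 1).factorial := by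
  induction s using Finset.induction_on_max with
  | empty => simp
  | insert a s ha ih =>
    have hnot : a ∉ s := fun h => lt_irrefl _ (ha a h)
    have h1 : (insert a s).filter (· < a) = s := by
      rw [Finset.filter_insert, if_neg (lt_irrefl a), Finset.filter_true_of_mem ha]
    have h2 : ∀ v ∈ s, (insert a s).filter (· < v) = s.filter (· < v) := fun v hv => by
      rw [Finset.filter_insert, if_neg (ha v hv).not_gt]
    rw [Finset.prod_insert hnot, h1, Finset.prod_congr rfl fun v hv => by rw [h2 v hv], ih,
      Finset.card_insert_of_notMem hnot, Nat.add_sub_cancel]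
    rcases Nat.eq_zero_or_pos s.card with h | h
    · simp [h]
    · rw [max_eq_right h, Nat.mul_factorial_pred h.ne']

section Fiber

variable {n : ℕ} {f h : Fin n → Fin n}

theorem IsRec.apply_of_fixed {v : Fin n} (hv : f v = v) : IsRec f v := fun k =>
  (Function.iterate_fixed hv k).le

theorem cutRecords_iterate {v : Fin n} {k : ℕ} (hk : ∀ i < k, ¬ IsRec f (f^[i] v)) :
    (cutRecords f)^[k] v = f^[k] v := by
  induction k with
  | zero => rfl
  | succ k ih =>
    rw [Function.iterate_succ_apply', Function.iterate_succ_apply',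
      ih fun i hi => hk i (hi.trans k.lt_succ_self), cutRecords, if_neg (hk k k.lt_succ_self)]

theorem cutRecords_eq_self_iff {v : Fin n} : cutRecords f v = v ↔ IsRec f v := by
  unfold cutRecords
  split_ifs with hv
  · simp [hv]
  · exact ⟨fun h => IsRec.apply_of_fixed h, fun h => absurd h hv⟩

theorem isMaxRootedForest_cutRecords (f : Fin n → Fin n) : IsMaxRootedForest (cutRecords f) := by
  intro v
  induction v using WellFoundedGT.induction with
  | _ v ih =>
    by_cases hv : IsRec f v
    · exact ⟨0, cutRecords_eq_self_iff.2 hv, le_rfl⟩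
    · have hex : ∃ k, v < f^[k] v := by simpa [IsRec] using hv
      have hlt := Nat.find_spec hex
      have hle : ∀ i < Nat.find hex, f^[i] v ≤ v := fun i hi => not_lt.1 (Nat.find_min hex hi)
      generalize Nat.find hex = k at hlt hle
      have hcut : (cutRecords f)^[k] v = f^[k] v := by
        refine cutRecords_iterate fun i hi hrec => ?_
        have := hrec (k - i)
        rw [← Function.iterate_add_apply, Nat.sub_add_cancel hi.le] at this
        exact absurd (this.trans (hle i hi)) hlt.not_ge
      obtain ⟨j, hj, hle'⟩ := ih _ hlt
      refine ⟨j + k, ?_, ?_⟩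
      · rw [Function.iterate_add_apply, hcut, hj]
      · rw [Function.iterate_add_apply, hcut]
        exact hlt.le.trans hle'

/-- If the records induce a connected subgraph, then the parent of a record is a record. -/
theorem IsTreeFun.isRec_apply (hf : IsTreeFun f)
    (hc : ((treeGraph f).induce {v | IsRec f v}).Connected) {m : Fin n} (hm : IsRec f m) :
    IsRec f (f m) := by
  by_contra hnot
  obtain ⟨r, hr, hroot⟩ := hf
  have hne : f m ≠ m := fun e => hnot (by rwa [e])
  obtain ⟨k, hk⟩ := (hc.preconnected ⟨m, hm⟩ ⟨r, IsRec.apply_of_fixed hr⟩).invariant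
    (P := fun w => ∃ k, f^[k] w.1 = m) (by
      rintro ⟨a, ha⟩ ⟨b, hb⟩ ⟨-, hab | hba⟩ ⟨k, hk⟩
      · cases k with
        | zero =>
          obtain rfl : a = m := hk
          exact absurd (hab ▸ hb) hnot
        | succ k => exact ⟨k, by rw [← hk, Function.iterate_succ_apply]; exact congrArg _ hab.symm⟩
      · exact ⟨k + 1, by
          rw [Function.iterate_succ_apply, ← hk]
          exact congrArg _ hba⟩) ⟨0, rfl⟩
  rw [Function.iterate_fixed hr] at hk
  exact hne (hk ▸ hr)

theorem connected_records_and_cutRecords_eq_iff (H : IsMaxRootedForest h) (hn : 1 ≤ n) :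
    ((IsTreeFun f ∧ ((treeGraph f).induce {v | IsRec f v}).Connected) ∧ cutRecords f = h) ↔
      (∀ v, h v ≠ v → f v = h v) ∧ ∀ m, h m = m →
        h (f m) = f m ∧ (f m < m ∨ f m = m ∧ ∀ w, h w = w → m ≤ w) := by
  constructor
  · rintro ⟨⟨hf, hc⟩, rfl⟩
    simp only [ne_eq, cutRecords_eq_self_iff]
    refine ⟨fun v hv => by rw [cutRecords, if_neg hv],
      fun m hm => ⟨hf.isRec_apply hc hm, (hm 1).lt_or_eq.imp id fun e => ⟨e, fun w hw => ?_⟩⟩⟩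
    obtain ⟨r, hr, hroot⟩ := hf
    obtain ⟨k, hk⟩ := hroot m
    obtain ⟨j, hj⟩ := hroot w
    have e' : f m = m := e
    rw [Function.iterate_fixed e'] at hk
    have := hw j
    rwa [hj, ← hk] at this
  · rintro ⟨hA, hB⟩
    obtain ⟨r, hr, hmin⟩ : ∃ r, h r = r ∧ ∀ w, h w = w → r ≤ w := by
      obtain ⟨k, hk, -⟩ := H ⟨0, hn⟩
      obtain ⟨r, hr⟩ := (Set.toFinite {v | h v = v}).exists_minimal ⟨_, hk⟩
      exact ⟨r, hr.1, fun w hw => (le_total r w).elim id fun e => hr.2 hw e⟩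
    have hfr : f r = r := by
      obtain ⟨h1, h2 | h2⟩ := hB r hr
      · exact absurd (hmin _ h1) h2.not_ge
      · exact h2.1
    have hdesc : ∀ v, h v = v → ∃ k, f^[k] v = r := by
      intro v
      induction v using WellFoundedLT.induction with
      | _ v ih =>
        intro hv
        obtain ⟨h1, h2 | ⟨-, h2⟩⟩ := hB v hv
        · obtain ⟨k, hk⟩ := ih _ h2 h1
          exact ⟨k + 1, hk⟩
        · exact ⟨0, le_antisymm (h2 r hr) (hmin v hv)⟩
    have hup : ∀ k v, h (h^[k] v) = h^[k] v → ∃ j, f^[j] v = h^[k] v := by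
      intro k
      induction k with
      | zero => exact fun v _ => ⟨0, rfl⟩
      | succ k ih =>
        intro v hk
        by_cases hv : h v = v
        · exact ⟨0, (Function.iterate_fixed hv _).symm⟩
        · obtain ⟨j, hj⟩ := ih (h v) hk
          exact ⟨j + 1, by rw [Function.iterate_succ_apply, hA v hv, hj]; rfl⟩
    have hrec : ∀ v, IsRec f v ↔ h v = v := by
      intro v
      constructor
      · intro hv
        obtain ⟨k, hk, hle⟩ := H v
        obtain ⟨j, hj⟩ := hup k v hk
        have : h^[k] v = v := le_antisymm (hj ▸ hv j) hle
        rwa [this] at hk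
      · intro hv k
        have : h (f^[k] v) = f^[k] v ∧ f^[k] v ≤ v := by
          induction k with
          | zero => exact ⟨hv, le_rfl⟩
          | succ k ih =>
            rw [Function.iterate_succ_apply']
            obtain ⟨h1, h2⟩ := hB _ ih.1
            exact ⟨h1, (h2.elim le_of_lt fun e => e.1.le).trans ih.2⟩
        exact this.2
    refine ⟨⟨⟨r, hfr, fun v => ?_⟩, ?_⟩, ?_⟩
    · obtain ⟨k, hk, -⟩ := H v
      obtain ⟨j, hj⟩ := hup k v hk
      obtain ⟨i, hi⟩ := hdesc _ hk
      exact ⟨i + j, by rw [Function.iterate_add_apply, hj, hi]⟩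
    · have hreach : ∀ v (hv : IsRec f v), ((treeGraph f).induce {v | IsRec f v}).Reachable
          ⟨v, hv⟩ ⟨r, (hrec r).2 hr⟩ := by
        intro v
        induction v using WellFoundedLT.induction with
        | _ v ih =>
          intro hv
          obtain ⟨h1, h2 | ⟨-, h2⟩⟩ := hB v ((hrec v).1 hv)
          · refine SimpleGraph.Reachable.trans (SimpleGraph.Adj.reachable ?_)
              (ih _ h2 ((hrec _).2 h1))
            exact ⟨h2.ne', Or.inl rfl⟩
          · obtain rfl : v = r := le_antisymm (h2 r hr) (hmin v ((hrec v).1 hv))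
            rfl
      have : Nonempty {v | IsRec f v} := ⟨⟨r, (hrec r).2 hr⟩⟩
      exact ⟨fun u v => (hreach u.1 u.2).trans (hreach v.1 v.2).symm⟩
    · funext v
      by_cases hv : h v = v
      · rw [cutRecords, if_pos ((hrec v).2 hv), hv]
      · rw [cutRecords, if_neg (mt (hrec v).1 hv), hA v hv]

theorem IsMaxRootedForest.card_fiber (H : IsMaxRootedForest h) (hn : 1 ≤ n) :
    Nat.card {f : Fin n → Fin n //
      (IsTreeFun f ∧ ((treeGraph f).induce {v | IsRec f v}).Connected) ∧ cutRecords f = h} =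
      ((Finset.univ.filter fun v => h v = v).card - 1).factorial := by
  set M := Finset.univ.filter fun v => h v = v with hM
  let S : Fin n → Finset (Fin n) := fun v =>
    if h v = v then if M.filter (· < v) = ∅ then {v} else M.filter (· < v) else {h v}
  have hiff : ∀ f : Fin n → Fin n, ((IsTreeFun f ∧
      ((treeGraph f).induce {v | IsRec f v}).Connected) ∧ cutRecords f = h) ↔
      f ∈ Fintype.piFinset S := by
    intro f
    rw [connected_records_and_cutRecords_eq_iff H hn, Fintype.mem_piFinset, ← forall_and]
    refine forall_congr' fun v => ?_
    by_cases hv : h v = v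
    · by_cases he : M.filter (· < v) = ∅
      · have hmin : ∀ w, h w = w → v ≤ w := by
          simpa [hM, Finset.filter_eq_empty_iff] using he
        simp only [S, hv, he, if_true, Finset.mem_singleton, ne_eq, not_true_eq_false,
          false_imp_iff, true_and, true_imp_iff]
        constructor
        · rintro ⟨h1, h2 | h2⟩
          · exact absurd (hmin _ h1) h2.not_ge
          · exact h2.1
        · intro e
          exact ⟨by rw [e, hv], Or.inr ⟨e, hmin⟩⟩
      · have hmin : ¬ ∀ w, h w = w → v ≤ w := by
          simpa [hM, Finset.filter_eq_empty_iff] using he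
        simp [S, hv, hmin, hM]
    · simp [S, hv]
  simp_rw [hiff]
  rw [Nat.card_eq_fintype_card, Fintype.card_coe, Fintype.card_piFinset, ← prod_card_filter_lt,
    ← Finset.prod_subset (Finset.subset_univ M)]
  · refine Finset.prod_congr rfl fun v hv => ?_
    have hv' : h v = v := by simpa [hM] using hv
    by_cases he : M.filter (· < v) = ∅
    · simp only [S, hv', he, if_true, Finset.card_singleton, Finset.card_empty]
      rfl
    · simp only [S, hv', he, if_true, if_false]
      exact (max_eq_right (Finset.card_pos.2 (Finset.nonempty_iff_ne_empty.2 he))).symm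
  · intro v _ hv
    have hv' : h v ≠ v := by simpa [hM] using hv
    simp [S, hv']

end Fiber

/-- The number of rooted labeled trees of order `n` whose records induce a
connected subgraph equals the number of cyclic sequences of vertex-disjoint
unrooted labeled trees covering `{1,…,n}`: the latter are encoded as an acyclic
graph `G` on `Fin n` (a forest, whose components are the unrooted trees) together
with a permutation of its connected components acting transitively
(a cyclic arrangement of the components). -/
theorem stmt8 (n : ℕ) (hn : 1 ≤ n) :
    Nat.card {f : Fin n → Fin n // IsTreeFun f ∧
        ((treeGraph f).induce {v | IsRec f v}).Connected} =
      Nat.card (Σ G : {G : SimpleGraph (Fin n) // G.IsAcyclic},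
        {σ : Equiv.Perm G.1.ConnectedComponent // ∀ c c', ∃ i : ℕ, (σ ^ i) c = c'}) := by
  let cut : {f : Fin n → Fin n // IsTreeFun f ∧
      ((treeGraph f).induce {v | IsRec f v}).Connected} →
      {h : Fin n → Fin n // IsMaxRootedForest h} :=
    fun f => ⟨cutRecords f.1, isMaxRootedForest_cutRecords f.1⟩
  rw [← Nat.card_congr (Equiv.sigmaFiberEquiv cut), Nat.card_sigma, Nat.card_sigma]
  refine Fintype.sum_equiv (maxRootedForestEquiv n) _ _ fun h => ?_
  have hcc : Nonempty (treeGraph h.1).ConnectedComponent :=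
    ⟨(treeGraph h.1).connectedComponentMk ⟨0, hn⟩⟩
  refine Eq.trans ?_ (card_transitive_perm (α := (treeGraph h.1).ConnectedComponent)).symm
  rw [h.2.card_connectedComponent, ← h.2.card_fiber hn]
  refine Nat.card_congr ((Equiv.subtypeEquivRight fun f => ?_).trans
    (Equiv.subtypeSubtypeEquivSubtypeInter _ fun f => cutRecords f = h.1))
  exact Subtype.ext_iff
end

section
/- The sum over all rooted labeled trees on {1,...,n} of (number of records minus 1) equals (n-1)! · Σ_{k=0}^{n-1} n^k/k! − n^(n-1). -/
open scoped Classical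

/-- The forward orbit of `x` under `f`. -/
def orbitSet {α : Type*} (f : α → α) (x : α) : Set α :=
  {y | ∃ k, f^[k] x = y}

/-- `f` is the parent function of a rooted forest whose set of roots is `S`. -/
def IsForestFun {α : Type*} (f : α → α) (S : Finset α) : Prop :=
  (∀ s ∈ S, f s = s) ∧ ∀ v, ∃ s ∈ S, s ∈ orbitSet f v

section Orbit

variable {α : Type*} {f : α → α} {u x y : α}

lemma self_mem_orbitSet (f : α → α) (x : α) : x ∈ orbitSet f x := ⟨0, rfl⟩

lemma orbitSet_subset (h : y ∈ orbitSet f x) : orbitSet f y ⊆ orbitSet f x := by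
  obtain ⟨k, rfl⟩ := h
  rintro _ ⟨j, rfl⟩
  exact ⟨j + k, Function.iterate_add_apply f j k x⟩

lemma apply_mem_orbitSet (h : y ∈ orbitSet f x) : f y ∈ orbitSet f x :=
  orbitSet_subset h ⟨1, rfl⟩

lemma orbitSet_eq_insert (f : α → α) (x : α) :
    orbitSet f x = insert x (orbitSet f (f x)) := by
  ext y
  constructor
  · rintro ⟨_ | k, rfl⟩
    · exact Or.inl rfl
    · exact Or.inr ⟨k, rfl⟩
  · rintro (rfl | h)
    · exact self_mem_orbitSet f y
    · exact orbitSet_subset (apply_mem_orbitSet (self_mem_orbitSet f x)) h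

lemma orbitSet_eq_singleton (h : f x = x) : orbitSet f x = {x} := by
  ext y
  constructor
  · rintro ⟨k, rfl⟩
    exact Function.iterate_fixed h k
  · rintro rfl
    exact self_mem_orbitSet f y

lemma eq_of_fixed_mem_orbitSet {s t : α} (hs : f s = s) (ht : f t = t)
    (hsx : s ∈ orbitSet f x) (htx : t ∈ orbitSet f x) : s = t := by
  obtain ⟨j, hj⟩ := hsx
  obtain ⟨k, hk⟩ := htx
  rw [← Function.iterate_fixed hs k, ← hj, ← Function.iterate_add_apply, add_comm,
    Function.iterate_add_apply, hk, Function.iterate_fixed ht j]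

lemma orbitSet_conj (σ : Equiv.Perm α) (f : α → α) (x : α) :
    orbitSet (σ ∘ f ∘ σ.symm) (σ x) = Set.image σ (orbitSet f x) := by
  have h : Function.Semiconj σ f (σ ∘ f ∘ σ.symm) := fun z => by simp
  ext y
  simp only [orbitSet, Set.mem_ofPred_eq, Set.mem_image]
  constructor
  · rintro ⟨k, rfl⟩
    exact ⟨_, ⟨k, rfl⟩, (h.iterate_right k) x⟩
  · rintro ⟨_, ⟨k, rfl⟩, rfl⟩
    exact ⟨k, ((h.iterate_right k) x).symm⟩

variable [DecidableEq α]

lemma orbitSet_update (h : u ∉ orbitSet f x) :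
    orbitSet (Function.update f u y) x = orbitSet f x := by
  have key : ∀ k, (Function.update f u y)^[k] x = f^[k] x := by
    intro k
    induction k with
    | zero => rfl
    | succ k ih =>
      rw [Function.iterate_succ_apply', Function.iterate_succ_apply', ih,
        Function.update_of_ne fun hk => h ⟨k, hk⟩]
  simp only [orbitSet, key]

lemma mem_orbitSet_update (h : u ∈ orbitSet f x) :
    u ∈ orbitSet (Function.update f u y) x := by
  obtain ⟨k, hk⟩ := h
  induction k generalizing x with
  | zero => exact ⟨0, hk⟩
  | succ k ih =>
    by_cases hx : x = u
    · exact ⟨0, hx⟩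
    · rw [orbitSet_eq_insert, Function.update_of_ne hx]
      exact Or.inr (ih hk)

end Orbit

section Forest

variable {α : Type*} {f : α → α} {u x y : α} {S : Finset α}

lemma IsForestFun.notMem_orbitSet_apply (h : IsForestFun f S) (hu : u ∉ S) :
    u ∉ orbitSet f (f u) := by
  rintro ⟨k, hk⟩
  obtain ⟨s, hs, j, hj⟩ := h.2 u
  have hper : f^[(k + 1) * j] u = u := by
    rw [Function.iterate_mul]
    exact Function.iterate_fixed hk j
  rw [add_mul, one_mul, Function.iterate_add_apply, hj,
    Function.iterate_fixed (h.1 s hs)] at hper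
  exact hu (hper ▸ hs)

lemma IsForestFun.conj (σ : Equiv.Perm α) (hσ : ∀ s ∈ S, σ s ∈ S) (hσ' : ∀ s ∈ S, σ.symm s ∈ S)
    (h : IsForestFun f S) : IsForestFun (σ ∘ f ∘ σ.symm) S := by
  refine ⟨fun s hs => ?_, fun v => ?_⟩
  · simp [h.1 _ (hσ' s hs)]
  · obtain ⟨s, hs, hsv⟩ := h.2 (σ.symm v)
    refine ⟨σ s, hσ s hs, ?_⟩
    rw [← σ.apply_symm_apply v, orbitSet_conj]
    exact Set.mem_image_of_mem σ hsv

variable [DecidableEq α]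

lemma IsForestFun.orbitSet_update_apply (h : IsForestFun f S) (hu : u ∉ S) :
    orbitSet (Function.update f u u) (f u) = orbitSet f (f u) :=
  orbitSet_update (h.notMem_orbitSet_apply hu)

/-- Cutting the edge above `u` makes `u` a root. -/
lemma IsForestFun.update_self (h : IsForestFun f S) (u : α) :
    IsForestFun (Function.update f u u) (insert u S) := by
  refine ⟨fun s hs => ?_, fun v => ?_⟩
  · by_cases hsu : s = u
    · simp [hsu]
    · rw [Function.update_of_ne hsu]
      exact h.1 s (Finset.mem_of_mem_insert_of_ne hs hsu)
  · by_cases hv : u ∈ orbitSet f v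
    · exact ⟨u, Finset.mem_insert_self u S, mem_orbitSet_update hv⟩
    · obtain ⟨s, hs, hsv⟩ := h.2 v
      exact ⟨s, Finset.mem_insert_of_mem hs, by rwa [orbitSet_update hv]⟩

lemma IsForestFun.notMem_orbitSet_of_mem (h : IsForestFun f (insert u S)) (hu : u ∉ S)
    (hx : ∃ s ∈ S, s ∈ orbitSet f x) : u ∉ orbitSet f x := by
  obtain ⟨s, hs, hsx⟩ := hx
  intro hux
  have := eq_of_fixed_mem_orbitSet (h.1 s (Finset.mem_insert_of_mem hs))
    (h.1 u (Finset.mem_insert_self u S)) hsx hux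
  exact hu (this ▸ hs)

/-- Hanging the root `u` below a vertex `x` of another tree. -/
lemma IsForestFun.update_of_mem (h : IsForestFun f (insert u S)) (hu : u ∉ S)
    (hx : ∃ s ∈ S, s ∈ orbitSet f x) : IsForestFun (Function.update f u x) S := by
  have hux := h.notMem_orbitSet_of_mem hu hx
  obtain ⟨s, hs, hsx⟩ := hx
  refine ⟨fun t ht => ?_, fun v => ?_⟩
  · rw [Function.update_of_ne (ne_of_mem_of_not_mem ht hu)]
    exact h.1 t (Finset.mem_insert_of_mem ht)
  · by_cases hv : u ∈ orbitSet f v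
    · refine ⟨s, hs, orbitSet_subset (apply_mem_orbitSet (mem_orbitSet_update hv)) ?_⟩
      rwa [Function.update_self, orbitSet_update hux]
    · obtain ⟨t, ht, htv⟩ := h.2 v
      have htu : t ≠ u := fun e => hv (e ▸ htv)
      exact ⟨t, Finset.mem_of_mem_insert_of_ne ht htu, by rwa [orbitSet_update hv]⟩

end Forest

section Counting

lemma Nat.card_subtype_eq_sum_of_existsUnique {β γ : Type*} [Finite β] {P : β → Prop}
    {Q : β → γ → Prop} {T : Finset γ} (h : ∀ a, P a → ∃! t, t ∈ T ∧ Q a t) :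
    Nat.card {a // P a} = ∑ t ∈ T, Nat.card {a // P a ∧ Q a t} := by
  have := Fintype.ofFinite β
  have hrw : ∀ R : β → Prop, Nat.card {a // R a} = ∑ a : β, if R a then 1 else 0 := by
    intro R
    rw [Nat.card_eq_fintype_card, Fintype.card_subtype, Finset.card_filter]
  simp only [hrw]
  rw [Finset.sum_comm]
  refine Finset.sum_congr rfl fun a _ => ?_
  by_cases ha : P a
  · obtain ⟨t, ⟨ht, hQ⟩, huniq⟩ := h a ha
    symm
    rw [Finset.sum_eq_single_of_mem t ht]
    · simp [ha, hQ]
    · exact fun s hs hst => if_neg fun hPQ => hst (huniq s ⟨hs, hPQ.2⟩)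
  · simp [ha]

lemma Nat.card_subtype_eq_of_inverse {β γ : Type*} {P : β → Prop} {Q : γ → Prop}
    (i : β → γ) (j : γ → β) (hi : ∀ a, P a → Q (i a)) (hj : ∀ b, Q b → P (j b))
    (hji : ∀ a, P a → j (i a) = a) (hij : ∀ b, Q b → i (j b) = b) :
    Nat.card {a // P a} = Nat.card {b // Q b} :=
  Nat.card_congr
    { toFun := fun a => ⟨i a, hi a a.2⟩
      invFun := fun b => ⟨j b, hj b b.2⟩
      left_inv := fun a => Subtype.ext (hji a a.2)
      right_inv := fun b => Subtype.ext (hij b b.2) }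

/-- By symmetry, every root of a uniform random forest has the same expected tree size. -/
lemma card_forest_orbitSet_mem_eq {α : Type*} [DecidableEq α] {S : Finset α} {t t' : α}
    (ht : t ∈ S) (ht' : t' ∈ S) :
    Nat.card {p : (α → α) × α // IsForestFun p.1 S ∧ t ∈ orbitSet p.1 p.2} =
      Nat.card {p : (α → α) × α // IsForestFun p.1 S ∧ t' ∈ orbitSet p.1 p.2} := by
  set σ := Equiv.swap t t' with hσdef
  have hσ : ∀ s ∈ S, σ s ∈ S := by
    intro s hs
    rw [hσdef, Equiv.swap_apply_def]
    split_ifs <;> assumption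
  have hsymm : σ.symm = σ := Equiv.symm_swap t t'
  have hconj : ∀ {f : α → α}, IsForestFun f S → IsForestFun (σ ∘ f ∘ σ) S := by
    intro f hf
    have := hf.conj σ hσ (by rwa [hsymm])
    rwa [hsymm] at this
  have horb : ∀ (f : α → α) x, orbitSet (σ ∘ f ∘ σ) (σ x) = Set.image σ (orbitSet f x) := by
    intro f x
    have := orbitSet_conj σ f x
    rwa [hsymm] at this
  have hinv : ∀ z, σ (σ z) = z := Equiv.swap_apply_self t t'
  refine Nat.card_subtype_eq_of_inverse (fun p => (σ ∘ p.1 ∘ σ, σ p.2))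
    (fun p => (σ ∘ p.1 ∘ σ, σ p.2)) ?_ ?_ ?_ ?_
  · rintro ⟨f, x⟩ ⟨hf, hx⟩
    refine ⟨hconj hf, ?_⟩
    simp only [horb]
    exact ⟨t, hx, Equiv.swap_apply_left t t'⟩
  · rintro ⟨f, x⟩ ⟨hf, hx⟩
    refine ⟨hconj hf, ?_⟩
    simp only [horb]
    exact ⟨t', hx, Equiv.swap_apply_right t t'⟩
  · rintro ⟨f, x⟩ -
    ext <;> simp [hinv]
  · rintro ⟨f, x⟩ -
    ext <;> simp [hinv]

variable {α : Type*} [Finite α]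

lemma card_mul_card_forest_eq_sum (T : Finset α) :
    Nat.card α * Nat.card {f : α → α // IsForestFun f T} =
      ∑ t ∈ T, Nat.card {p : (α → α) × α // IsForestFun p.1 T ∧ t ∈ orbitSet p.1 p.2} := by
  rw [← Nat.card_subtype_eq_sum_of_existsUnique (P := fun p : (α → α) × α => IsForestFun p.1 T)
    (Q := fun p t => t ∈ orbitSet p.1 p.2), mul_comm, ← Nat.card_prod]
  · exact Nat.card_congr
      { toFun := fun q => ⟨(q.1.1, q.2), q.1.2⟩
        invFun := fun p => (⟨p.1.1, p.2⟩, p.1.2)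
        left_inv := fun _ => rfl
        right_inv := fun _ => rfl }
  · rintro ⟨f, x⟩ hf
    obtain ⟨s, hs, hsx⟩ := hf.2 x
    exact ⟨s, ⟨hs, hsx⟩, fun t ht => eq_of_fixed_mem_orbitSet (hf.1 t ht.1) (hf.1 s hs) ht.2 hsx⟩

variable [DecidableEq α]

lemma card_forest_eq_sum {S : Finset α} {u : α} (hu : u ∉ S) :
    Nat.card {f : α → α // IsForestFun f S} =
      ∑ t ∈ S, Nat.card {p : (α → α) × α //
        IsForestFun p.1 (insert u S) ∧ t ∈ orbitSet p.1 p.2} := by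
  have h : Nat.card {f : α → α // IsForestFun f S} =
      Nat.card {p : (α → α) × α //
        IsForestFun p.1 (insert u S) ∧ ∃ s ∈ S, s ∈ orbitSet p.1 p.2} := by
    refine Nat.card_subtype_eq_of_inverse (fun f => (Function.update f u u, f u))
      (fun p => Function.update p.1 u p.2) ?_ ?_ ?_ ?_
    · intro f hf
      refine ⟨hf.update_self u, ?_⟩
      simp only [hf.orbitSet_update_apply hu]
      exact hf.2 (f u)
    · rintro ⟨g, x⟩ ⟨hg, hx⟩
      exact hg.update_of_mem hu hx
    · intro f _
      simp
    · rintro ⟨g, x⟩ ⟨hg, -⟩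
      have := hg.1 u (Finset.mem_insert_self u S)
      ext
      · simp only [Function.update_idem]
        rw [Function.update_eq_self_iff.2 this.symm]
      · simp
  rw [h, Nat.card_subtype_eq_sum_of_existsUnique
    (Q := fun p t => t ∈ orbitSet p.1 p.2) (T := S)]
  · refine Finset.sum_congr rfl fun t ht => Nat.card_congr (Equiv.subtypeEquivRight fun p => ?_)
    exact ⟨fun hp => ⟨hp.1.1, hp.2⟩, fun hp => ⟨⟨hp.1, t, ht, hp.2⟩, hp.2⟩⟩
  · rintro ⟨f, x⟩ ⟨hf, s, hs, hsx⟩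
    exact ⟨s, ⟨hs, hsx⟩, fun t ht => eq_of_fixed_mem_orbitSet
      (hf.1 t (Finset.mem_insert_of_mem ht.1)) (hf.1 s (Finset.mem_insert_of_mem hs)) ht.2 hsx⟩

/-- Cayley's formula for forests with a prescribed set of roots. -/
theorem card_mul_card_forest (S : Finset α) :
    Nat.card α * Nat.card {f : α → α // IsForestFun f S} =
      S.card * Nat.card α ^ (Nat.card α - S.card) := by
  have := Fintype.ofFinite α
  induction hm : Nat.card α - S.card generalizing S with
  | zero =>
    have hS : S = Finset.univ := by
      rw [← Finset.card_eq_iff_eq_univ, ← Nat.card_eq_fintype_card]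
      have := Finset.card_le_univ S
      rw [← Nat.card_eq_fintype_card] at this
      omega
    have hone : Nat.card {f : α → α // IsForestFun f S} = 1 := by
      rw [Nat.card_eq_one_iff_unique]
      refine ⟨⟨fun f g => Subtype.ext (funext fun x => ?_)⟩, ⟨⟨id, ?_⟩⟩⟩
      · rw [f.2.1 x (by simp [hS]), g.2.1 x (by simp [hS])]
      · exact ⟨fun _ _ => rfl, fun v => ⟨v, by simp [hS], self_mem_orbitSet _ _⟩⟩
    rw [hone, hS, Finset.card_univ, Nat.card_eq_fintype_card, pow_zero]
  | succ m ih =>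
    obtain ⟨u, hu⟩ : ∃ u, u ∉ S := by
      by_contra! hall
      rw [Finset.eq_univ_iff_forall.2 hall, Finset.card_univ, Nat.card_eq_fintype_card] at hm
      omega
    have hcard := Finset.card_insert_of_notMem hu
    set N := Nat.card {p : (α → α) × α //
      IsForestFun p.1 (insert u S) ∧ u ∈ orbitSet p.1 p.2} with hN
    have hsymm : ∀ t ∈ insert u S, Nat.card {p : (α → α) × α //
        IsForestFun p.1 (insert u S) ∧ t ∈ orbitSet p.1 p.2} = N := fun t ht =>
      card_forest_orbitSet_mem_eq ht (Finset.mem_insert_self u S)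
    have hNval : N = Nat.card α ^ m := by
      have h := ih (insert u S) (by omega)
      rw [card_mul_card_forest_eq_sum, Finset.sum_congr rfl hsymm, Finset.sum_const,
        smul_eq_mul, hcard] at h
      exact Nat.eq_of_mul_eq_mul_left (Nat.succ_pos _) h
    rw [card_forest_eq_sum hu,
      Finset.sum_congr rfl fun t ht => hsymm t (Finset.mem_insert_of_mem ht),
      Finset.sum_const, smul_eq_mul, hNval, pow_succ]
    ring

/-- Forests whose roots are `R` and the last vertex of a path that starts at `v` and visits
exactly `A`, with `A` disjoint from `R`. -/
lemma card_forest_orbitSet_eq (A R : Finset α) (hAR : Disjoint A R) {v : α} (hv : v ∈ A) :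
    Nat.card {f : α → α // (∃ r, IsForestFun f (insert r R)) ∧ orbitSet f v = A} =
      (A.card - 1).factorial * Nat.card {f : α → α // IsForestFun f (A ∪ R)} := by
  induction hm : A.card - 1 generalizing A R v with
  | zero =>
    obtain rfl : A = {v} := by
      obtain ⟨a, rfl⟩ := Finset.card_eq_one.1
        (show A.card = 1 by have := Finset.card_pos.2 ⟨v, hv⟩; omega)
      rw [Finset.mem_singleton.1 hv]
    rw [Nat.factorial_zero, one_mul]
    refine Nat.card_congr (Equiv.subtypeEquivRight fun f => ?_)
    rw [← Finset.insert_eq]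
    constructor
    · rintro ⟨⟨r, hr⟩, horb⟩
      obtain ⟨s, hs, hsv⟩ := hr.2 v
      have hsv : s = v := by simpa [horb] using hsv
      rw [hsv] at hs
      have hvR : v ∉ R := Finset.disjoint_singleton_left.1 hAR
      have : v = r := (Finset.mem_insert.1 hs).resolve_right hvR
      rwa [this]
    · intro h
      refine ⟨⟨v, h⟩, ?_⟩
      rw [orbitSet_eq_singleton (h.1 v (Finset.mem_insert_self v R)), Finset.coe_singleton]
  | succ m ih =>
    have hvR : v ∉ R := Finset.disjoint_left.1 hAR hv
    have hdisj : Disjoint (A.erase v) (insert v R) := by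
      rw [Finset.disjoint_insert_right]
      exact ⟨Finset.notMem_erase v A, hAR.mono_left (Finset.erase_subset v A)⟩
    have hunion : A.erase v ∪ insert v R = A ∪ R := by
      rw [Finset.union_insert, ← Finset.insert_union, Finset.insert_erase hv]
    have hcard : (A.erase v).card = m + 1 := by
      rw [Finset.card_erase_of_mem hv, hm]
    have root_ne : ∀ {f : α → α} {r}, IsForestFun f (insert r R) → orbitSet f v = A →
        v ∉ insert r R := by
      intro f r hf horb hmem
      rw [orbitSet_eq_singleton (hf.1 v hmem), ← Finset.coe_singleton, Finset.coe_inj] at horb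
      rw [← horb, Finset.card_singleton] at hm
      omega
    have step : ∀ {f : α → α} {r}, IsForestFun f (insert r R) → orbitSet f v = A →
        orbitSet f (f v) = (A.erase v : Finset α) := by
      intro f r hf horb
      have h := hf.notMem_orbitSet_apply (root_ne hf horb)
      rw [orbitSet_eq_insert] at horb
      rw [Finset.coe_erase, ← horb, Set.insert_sdiff_self_of_notMem h]
    rw [Nat.card_subtype_eq_sum_of_existsUnique (Q := fun f w => f v = w) (T := A.erase v)]
    · rw [Finset.sum_congr rfl (g := fun _ => m.factorial *
        Nat.card {f : α → α // IsForestFun f (A ∪ R)}), Finset.sum_const, hcard, smul_eq_mul,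
        Nat.factorial_succ, mul_assoc]
      intro w hw
      rw [← hunion, ← ih (A.erase v) (insert v R) hdisj hw (by omega)]
      refine Nat.card_subtype_eq_of_inverse (fun f => Function.update f v v)
        (fun g => Function.update g v w) ?_ ?_ ?_ ?_
      · rintro f ⟨⟨⟨r, hf⟩, horb⟩, rfl⟩
        have hvr := root_ne hf horb
        refine ⟨⟨r, ?_⟩, ?_⟩
        · rw [Finset.insert_comm]
          exact hf.update_self v
        · rw [hf.orbitSet_update_apply hvr, step hf horb]
      · rintro g ⟨⟨r, hg⟩, horb⟩
        obtain ⟨s, hs, hsw⟩ := hg.2 w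
        have hsA : s ∈ A.erase v := by
          rw [horb] at hsw
          exact hsw
        have hsr : s = r := (Finset.mem_insert.1 hs).resolve_right
          (Finset.disjoint_left.1 hdisj hsA)
        have hvr : v ∉ insert r R := by
          rw [Finset.mem_insert, not_or]
          exact ⟨fun e => Finset.ne_of_mem_erase hsA (hsr.trans e.symm), hvR⟩
        rw [Finset.insert_comm] at hg
        refine ⟨⟨⟨r, hg.update_of_mem hvr ⟨s, ?_, hsw⟩⟩, ?_⟩, Function.update_self ..⟩
        · rw [hsr]
          exact Finset.mem_insert_self r R
        · have hvw : v ∉ orbitSet g w := by simp [horb]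
          rw [orbitSet_eq_insert, Function.update_self, orbitSet_update hvw, horb,
            ← Finset.coe_insert, Finset.insert_erase hv]
      · rintro f ⟨-, rfl⟩
        simp
      · rintro g ⟨⟨r, hg⟩, -⟩
        have := hg.1 v (by simp)
        simp only [Function.update_idem]
        rw [Function.update_eq_self_iff.2 this.symm]
    · rintro f ⟨⟨r, hf⟩, horb⟩
      refine ⟨f v, ⟨?_, rfl⟩, fun t ht => ht.2.symm⟩
      have := self_mem_orbitSet f (f v)
      rw [step hf horb] at this
      exact this

end Counting

section Trees

variable {n : ℕ}

lemma isTreeFun_iff {f : Fin n → Fin n} : IsTreeFun f ↔ ∃ r, IsForestFun f {r} := by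
  simp [IsTreeFun, IsForestFun, orbitSet]

/-- Cayley's formula: there are `n ^ (n - 1)` rooted labeled trees on `n` vertices. -/
theorem card_isTreeFun (hn : 1 ≤ n) :
    Nat.card {f : Fin n → Fin n // IsTreeFun f} = n ^ (n - 1) := by
  have hroot : Nat.card {f : Fin n → Fin n // IsTreeFun f} =
      ∑ r, Nat.card {f : Fin n → Fin n // IsForestFun f {r}} := by
    rw [Nat.card_subtype_eq_sum_of_existsUnique (Q := fun f r => IsForestFun f {r})
      (T := Finset.univ)]
    · refine Finset.sum_congr rfl fun r _ => Nat.card_congr (Equiv.subtypeEquivRight fun f => ?_)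
      exact ⟨fun h => h.2, fun h => ⟨isTreeFun_iff.2 ⟨r, h⟩, h⟩⟩
    · intro f hf
      obtain ⟨r, hr⟩ := isTreeFun_iff.1 hf
      refine ⟨r, ⟨Finset.mem_univ r, hr⟩, fun t ht => ?_⟩
      obtain ⟨s, hs, hst⟩ := hr.2 t
      rw [orbitSet_eq_singleton (ht.2.1 t (Finset.mem_singleton_self t))] at hst
      rw [← Finset.mem_singleton.1 hs]
      exact hst.symm
  apply Nat.eq_of_mul_eq_mul_left hn
  have hforest : ∀ r : Fin n, n * Nat.card {f : Fin n → Fin n // IsForestFun f {r}} =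
      n ^ (n - 1) := by
    intro r
    simpa using card_mul_card_forest ({r} : Finset (Fin n))
  rw [hroot, Finset.mul_sum, Finset.sum_congr rfl fun r _ => hforest r]
  simp

lemma isRec_iff {f : Fin n → Fin n} {v : Fin n} : IsRec f v ↔ ∀ x ∈ orbitSet f v, x ≤ v := by
  simp [IsRec, orbitSet]

lemma IsRec.eq_max' {f : Fin n → Fin n} {v : Fin n} {S : Finset (Fin n)} (h : IsRec f v)
    (horb : orbitSet f v = S) (hS : S.Nonempty) : v = S.max' hS := by
  have hmem : ∀ x, x ∈ orbitSet f v ↔ x ∈ S := fun x => by rw [horb, Finset.mem_coe]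
  exact le_antisymm (S.le_max' v ((hmem v).1 (self_mem_orbitSet f v)))
    (isRec_iff.1 h _ ((hmem _).2 (S.max'_mem hS)))

lemma mul_card_tree_record_orbitSet_eq (S : Finset (Fin n)) :
    n * Nat.card {p : (Fin n → Fin n) × Fin n //
        (IsTreeFun p.1 ∧ IsRec p.1 p.2) ∧ orbitSet p.1 p.2 = S} =
      (S.card - 1).factorial * (S.card * n ^ (n - S.card)) := by
  rcases S.eq_empty_or_nonempty with rfl | hS
  · have : IsEmpty {p : (Fin n → Fin n) × Fin n //
        (IsTreeFun p.1 ∧ IsRec p.1 p.2) ∧ orbitSet p.1 p.2 = (∅ : Finset (Fin n))} := by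
      refine ⟨fun p => ?_⟩
      have h := self_mem_orbitSet p.1.1 p.1.2
      simp [p.2.2] at h
    rw [Nat.card_of_isEmpty]
    simp
  · have hcount := card_forest_orbitSet_eq S ∅ (Finset.disjoint_empty_right S) (S.max'_mem hS)
    have hforest := card_mul_card_forest S
    rw [Nat.card_fin] at hforest
    rw [Finset.union_empty] at hcount
    rw [← hforest, mul_left_comm, ← hcount]
    congr 1
    refine Nat.card_subtype_eq_of_inverse (fun p => p.1) (fun f => (f, S.max' hS)) ?_ ?_ ?_ ?_
    · rintro ⟨f, v⟩ ⟨⟨ht, hrec⟩, horb⟩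
      refine ⟨by simpa using isTreeFun_iff.1 ht, ?_⟩
      rwa [← hrec.eq_max' horb hS]
    · rintro f ⟨ht, horb⟩
      refine ⟨⟨isTreeFun_iff.2 (by simpa using ht), isRec_iff.2 fun x hx => ?_⟩, horb⟩
      simp only [horb] at hx
      exact S.le_max' x hx
    · rintro ⟨f, v⟩ ⟨⟨-, hrec⟩, horb⟩
      exact Prod.ext rfl (hrec.eq_max' horb hS).symm
    · exact fun _ _ => rfl

theorem card_tree_record (hn : 1 ≤ n) :
    Nat.card {p : (Fin n → Fin n) × Fin n // IsTreeFun p.1 ∧ IsRec p.1 p.2} =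
      ∑ k ∈ Finset.range n, (n - 1).descFactorial (n - 1 - k) * n ^ k := by
  apply Nat.eq_of_mul_eq_mul_left hn
  rw [Nat.card_subtype_eq_sum_of_existsUnique (Q := fun p (S : Finset (Fin n)) =>
    orbitSet p.1 p.2 = S) (T := Finset.univ), Finset.mul_sum,
    Finset.sum_congr rfl fun S _ => mul_card_tree_record_orbitSet_eq S, ← Finset.powerset_univ,
    Finset.sum_powerset_apply_card fun k => (k - 1).factorial * (k * n ^ (n - k)),
    Finset.card_univ, Fintype.card_fin, Finset.sum_range_succ', ← Finset.sum_range_reflect,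
    Finset.mul_sum]
  · simp only [Nat.zero_mul, Nat.mul_zero, smul_zero, add_zero]
    refine Finset.sum_congr rfl fun k hk => ?_
    have hk := Finset.mem_range.1 hk
    obtain ⟨m, rfl⟩ : ∃ m, n = m + 1 := ⟨n - 1, by omega⟩
    have hpow : m + 1 - (m - k + 1) = k := by omega
    have hdesc := Nat.succ_descFactorial_succ m (m - k)
    rw [Nat.descFactorial_eq_factorial_mul_choose, Nat.factorial_succ] at hdesc
    simp only [Nat.add_sub_cancel, hpow, smul_eq_mul]
    rw [← mul_assoc (m + 1), ← hdesc]
    ring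
  · intro p _
    refine ⟨(Set.toFinite (orbitSet p.1 p.2)).toFinset, by simp, fun S hS => ?_⟩
    rw [← Finset.coe_inj, ← hS.2, Set.Finite.coe_toFinset]

lemma IsTreeFun.card_isRec_pos {f : Fin n → Fin n} (hf : IsTreeFun f) :
    1 ≤ Nat.card {v : Fin n // IsRec f v} := by
  obtain ⟨r, hr, -⟩ := hf
  have : Nonempty {v : Fin n // IsRec f v} :=
    ⟨r, fun k => (Function.iterate_fixed hr k).le⟩
  exact Nat.card_pos

end Trees

/-- The sum over all rooted labeled trees on `{1,…,n}` of (number of records − 1)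
equals `(n-1)!·Σ_{k=0}^{n-1} n^k/k! − n^(n-1)`, where `(n-1)!/k!` is expressed as
the descending factorial `(n-1).descFactorial (n-1-k)`. -/
theorem stmt13 (n : ℕ) (hn : 1 ≤ n) :
    ∑ f ∈ Finset.univ.filter (fun f : Fin n → Fin n => IsTreeFun f),
        (Nat.card {v : Fin n // IsRec f v} - 1) =
      (∑ k ∈ Finset.range n, (n - 1).descFactorial (n - 1 - k) * n ^ k) - n ^ (n - 1) := by
  rw [Finset.sum_tsub_distrib _ fun f hf => (Finset.mem_filter.1 hf).2.card_isRec_pos,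
    ← card_tree_record hn, ← card_isTreeFun hn]
  congr 1
  · rw [Nat.card_subtype_eq_sum_of_existsUnique (Q := fun p f => p.1 = f)
      (T := Finset.univ.filter (fun f : Fin n → Fin n => IsTreeFun f))]
    · refine Finset.sum_congr rfl fun f hf => ?_
      have hf := (Finset.mem_filter.1 hf).2
      refine Nat.card_subtype_eq_of_inverse (fun v => (f, v)) (fun p => p.2) ?_ ?_ ?_ ?_
      · exact fun v hv => ⟨⟨hf, hv⟩, rfl⟩
      · rintro ⟨g, v⟩ ⟨⟨-, hv⟩, rfl⟩
        exact hv
      · exact fun _ _ => rfl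
      · rintro ⟨g, v⟩ ⟨-, rfl⟩
        rfl
    · rintro ⟨f, v⟩ ⟨hf, -⟩
      exact ⟨f, ⟨by simpa using hf, rfl⟩, fun g hg => hg.2.symm⟩
  · rw [Finset.sum_const, smul_eq_mul, mul_one, Nat.card_eq_fintype_card, Fintype.card_subtype]
end
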